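/- arXiv:1108.4840 — 2 statements merged into one kernel-verified Lean document; each statement's English description precedes it below -/
import Mathlib

section
/- Let p > 3 be a prime with Legendre symbol (p|23) = 1, and set S = ∑_{k=0}^{⌊p/3⌋} C(3k,k), with congruences interpreted in ℤ/pℤ. (i) If there exist x, y ∈ ℤ with p = x² + xy + 52y² or p = 8x² + 7xy + 8y², then S ≡ 1 (mod p). (ii) If p ≠ 13 and there exist x, y ∈ ℤ with p = 13x² + xy + 4y², then S ≡ (39x − 10y)/(23y) (mod p). (iii) If p ≠ 29 and there exist x, y ∈ ℤ with p = 29x² + 5xy + 2y², then S ≡ −(87x + 19y)/(23y) (mod p). -/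
instance : Fact (Nat.Prime 23) := ⟨by norm_num⟩

section CubicGaussSum

variable {l q : ℕ} [Fact l.Prime] [Fact q.Prime] {F : Type*} [Field F]

theorem sq_eq_inv_of_pow_three_eq_one {G : Type*} [Group G] {g : G} (h : g ^ 3 = 1) :
    g ^ 2 = g⁻¹ :=
  eq_inv_of_mul_eq_one_left (by rw [← pow_succ, h])

theorem gaussSum_sq_of_cubic {X : MulChar (ZMod l) F} (h3 : X ^ 3 = 1) (h1 : X ≠ 1)
    (ψ : AddChar (ZMod l) F) :
    gaussSum X⁻¹ ψ * jacobiSum X X = gaussSum X ψ ^ 2 := by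
  have h : X * X = X⁻¹ := by rw [← sq, sq_eq_inv_of_pow_three_eq_one h3]
  rw [← h, jacobiSum_mul_nontrivial (h ▸ inv_ne_one.2 h1), sq]

theorem exists_isPrimitive_addChar [IsAlgClosed F] [CharP F q] (hlq : l ≠ q) :
    ∃ ψ : AddChar (ZMod l) F, ψ.IsPrimitive := by
  have hl0 : (l : F) ≠ 0 := fun h ↦ hlq <|
    ((Nat.prime_dvd_prime_iff_eq Fact.out Fact.out).1 ((CharP.cast_eq_zero_iff F q l).1 h)).symm
  have : NeZero (l : F) := ⟨hl0⟩
  obtain ⟨z, hz⟩ := HasEnoughRootsOfUnity.exists_primitiveRoot F l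
  exact ⟨_, AddChar.zmodChar_primitive_of_primitive_root l hz⟩

/-- The rational case of cubic reciprocity, in terms of the Jacobi sum of a cubic character:
in characteristic `q`, the cubic residue symbol of `J(X, X)` at `q` is `X q`. -/
theorem jacobiSum_pow_of_cubic [IsAlgClosed F] [CharP F q] (hlq : l ≠ q)
    {X : MulChar (ZMod l) F} (h3 : X ^ 3 = 1) (h1 : X ≠ 1) (m : ℕ) :
    (q = 3 * m + 1 → jacobiSum X X ^ m = X q * jacobiSum X⁻¹ X⁻¹ ^ m) ∧
    (q = 3 * m + 2 → jacobiSum X⁻¹ X⁻¹ ^ (m + 1) = X q * jacobiSum X X ^ (m + 1)) := by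
  obtain ⟨ψ, hψ⟩ := exists_isPrimitive_addChar (F := F) hlq
  have hlF : (Fintype.card (ZMod l) : F) ≠ 0 := by
    rw [ZMod.card]
    exact fun h ↦ hlq <|
      ((Nat.prime_dvd_prime_iff_eq Fact.out Fact.out).1 ((CharP.cast_eq_zero_iff F q l).1 h)).symm
  have hq : ((q : ZMod l)) ≠ 0 := fun h ↦ hlq <|
    (Nat.prime_dvd_prime_iff_eq Fact.out Fact.out).1 ((ZMod.natCast_eq_zero_iff q l).1 h)
  have hu : IsUnit (q : ZMod l) := hq.isUnit
  have g0 := gaussSum_ne_zero_of_nontrivial hlF h1 hψ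
  have g0' := gaussSum_ne_zero_of_nontrivial hlF (inv_ne_one.2 h1) hψ
  have e := gaussSum_sq_of_cubic h3 h1 ψ
  have e' := gaussSum_sq_of_cubic (X := X⁻¹) (by rw [inv_pow, h3, inv_one]) (inv_ne_one.2 h1) ψ
  rw [inv_inv] at e'
  have frob (Y : MulChar (ZMod l) F) :
      gaussSum Y ψ ^ q = (Y ^ q)⁻¹ q * gaussSum (Y ^ q) ψ := by
    rw [gaussSum_frob q, AddChar.pow_mulShift, ← hu.unit_spec, gaussSum_mulShift_eq]
  have c3 : X q ^ 3 = 1 := by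
    rw [← MulChar.pow_apply' X (by norm_num), h3, MulChar.one_apply hu]
  have c0 : X q ≠ 0 := fun h ↦ by simp [h] at c3
  have ci : X⁻¹ q = X q ^ 2 := by
    rw [← sq_eq_inv_of_pow_three_eq_one h3, MulChar.pow_apply' X (by norm_num)]
  set g := gaussSum X ψ
  set g' := gaussSum X⁻¹ ψ
  set J := jacobiSum X X
  set J' := jacobiSum X⁻¹ X⁻¹
  have key (k : ℕ) : J ^ k * g' ^ (3 * k) = g ^ (3 * k) * J' ^ k := by
    rw [pow_mul, pow_mul, ← mul_pow, ← mul_pow]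
    congr 1
    linear_combination g' ^ 2 * e - g ^ 2 * e'
  constructor
  · intro hm
    have hX : X ^ q = X := by rw [hm, pow_succ, pow_mul, h3, one_pow, one_mul]
    have f := frob X
    have f' := frob X⁻¹
    rw [inv_pow, hX, inv_inv] at f'
    rw [hX, ci] at f
    have a : g ^ (3 * m) = X q ^ 2 := mul_right_cancel₀ g0 (by rw [← pow_succ, ← hm]; exact f)
    have a' : g' ^ (3 * m) = X q := mul_right_cancel₀ g0' (by rw [← pow_succ, ← hm]; exact f')
    have k := key m
    rw [a, a'] at k
    exact mul_right_cancel₀ c0 (by linear_combination k)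
  · intro hm
    have hX : X ^ q = X⁻¹ := by
      rw [hm, pow_add, pow_mul, h3, one_pow, one_mul, sq_eq_inv_of_pow_three_eq_one h3]
    have f := frob X
    have f' := frob X⁻¹
    rw [inv_pow, hX, inv_inv, ci] at f'
    rw [hX, inv_inv] at f
    have a : g ^ (3 * (m + 1)) = X q * g' * g := by
      rw [show 3 * (m + 1) = q + 1 by omega, pow_succ, f]
    have a' : g' ^ (3 * (m + 1)) = X q ^ 2 * g * g' := by
      rw [show 3 * (m + 1) = q + 1 by omega, pow_succ, f', inv_inv]
    have k := key (m + 1)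
    rw [a, a'] at k
    refine mul_right_cancel₀ (mul_ne_zero (mul_ne_zero c0 g0) g0') ?_
    linear_combination -k

end CubicGaussSum

/-- The norm of `a + b * ω` from `ℤ[ω]` to `ℤ`, where `ω ^ 2 + ω + 1 = 0`. -/
def eisNorm (a b : ℤ) : ℤ := a ^ 2 - a * b + b ^ 2

/-- `χ` is a cubic residue symbol modulo `eisNorm a b` which computes the symbol of
`α = a + b * ω` at every rational prime `q` prime to `3 * eisNorm a b`. The latter is
`(α / α') ^ k`, where `q = 3 * k + 1`, if `q % 3 = 1`, and `(α' / α) ^ k`, where `q = 3 * k - 1`,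
if `q % 3 = 2`. Here `α'` is the conjugate of `α`, and the symbol is read in characteristic `q`. -/
structure IsCubicSymbol (a b : ℤ) (χ : ℤ → ZMod 3) : Prop where
  apply_mul : ∀ m n, IsCoprime m (eisNorm a b) → IsCoprime n (eisNorm a b) → χ (m * n) = χ m + χ n
  congr : ∀ m n, eisNorm a b ∣ m - n → χ m = χ n
  split : ∀ q : ℕ, q.Prime → ¬ (q : ℤ) ∣ eisNorm a b →
    ∀ (F : Type) [Field F] [IsAlgClosed F] [CharP F q] (w : F), w ^ 2 + w + 1 = 0 →
      ∀ m, q = 3 * m + 1 →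
        ((a : F) + b * w) ^ m = w ^ (χ q).val * ((a : F) + b * (-1 - w)) ^ m
  inert : ∀ q : ℕ, q.Prime → ¬ (q : ℤ) ∣ eisNorm a b →
    ∀ (F : Type) [Field F] [IsAlgClosed F] [CharP F q] (w : F), w ^ 2 + w + 1 = 0 →
      ∀ m, q = 3 * m + 2 →
        ((a : F) + b * (-1 - w)) ^ (m + 1) = w ^ (χ q).val * ((a : F) + b * w) ^ (m + 1)

section CubeRoot

variable {F : Type*} [CommRing F] {w : F}

theorem cube_root_pow_three (hw : w ^ 2 + w + 1 = 0) : w ^ 3 = 1 := by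
  linear_combination (w - 1) * hw

theorem cube_root_pow_val_add (hw : w ^ 2 + w + 1 = 0) (a b : ZMod 3) :
    w ^ (a + b).val = w ^ a.val * w ^ b.val := by
  rw [ZMod.val_add, ← pow_add, ← pow_eq_pow_mod _ (cube_root_pow_three hw)]

theorem cube_root_pow_val_mul_neg (hw : w ^ 2 + w + 1 = 0) (a : ZMod 3) :
    w ^ a.val * w ^ (-a).val = 1 := by
  rw [← cube_root_pow_val_add hw, add_neg_cancel, ZMod.val_zero, pow_zero]

theorem cube_root_conj (hw : w ^ 2 + w + 1 = 0) : (-1 - w) ^ 2 + (-1 - w) + 1 = 0 := by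
  linear_combination hw

theorem cube_root_conj_pow_val (hw : w ^ 2 + w + 1 = 0) (a : ZMod 3) :
    (-1 - w) ^ a.val = w ^ (-a).val := by
  have h : w * (-1 - w) = 1 := by linear_combination -hw
  have := cube_root_pow_val_mul_neg hw a
  calc (-1 - w) ^ a.val = (-1 - w) ^ a.val * (w ^ a.val * w ^ (-a).val) := by rw [this, mul_one]
    _ = (w * (-1 - w)) ^ a.val * w ^ (-a).val := by rw [mul_pow]; ring
    _ = w ^ (-a).val := by rw [h, one_pow, one_mul]

theorem cube_root_pow_val_injective [IsDomain F] (h3 : (3 : F) ≠ 0) (hw : w ^ 2 + w + 1 = 0)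
    {a b : ZMod 3} (h : w ^ a.val = w ^ b.val) : a = b := by
  have h1 : w ≠ 1 := by
    rintro rfl
    exact h3 (by linear_combination hw)
  have ho : orderOf w = 3 := orderOf_eq_prime (cube_root_pow_three hw) h1
  exact ZMod.val_injective 3 (pow_injOn_Iio_orderOf (by simpa [ho] using ZMod.val_lt a)
    (by simpa [ho] using ZMod.val_lt b) h)

end CubeRoot

theorem eisNorm_mul (a b c d : ℤ) :
    eisNorm (a * c - b * d) (a * d + b * c - b * d) = eisNorm a b * eisNorm c d := by
  simp only [eisNorm]; ring

theorem eisNorm_conj (a b : ℤ) : eisNorm (a - b) (-b) = eisNorm a b := by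
  simp only [eisNorm]; ring

namespace IsCubicSymbol

theorem mul {a b c d : ℤ} {χ φ : ℤ → ZMod 3} (h : IsCubicSymbol a b χ)
    (k : IsCubicSymbol c d φ) :
    IsCubicSymbol (a * c - b * d) (a * d + b * c - b * d) (χ + φ) where
  apply_mul m n hm hn := by
    rw [eisNorm_mul] at hm hn
    have e := h.apply_mul m n hm.of_mul_right_left hn.of_mul_right_left
    have f := k.apply_mul m n hm.of_mul_right_right hn.of_mul_right_right
    simp only [Pi.add_apply, e, f]
    ring
  congr m n hmn := by
    rw [eisNorm_mul] at hmn
    rw [Pi.add_apply, h.congr m n (dvd_of_mul_right_dvd hmn),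
      k.congr m n (dvd_of_mul_left_dvd hmn), Pi.add_apply]
  split q hq hN F _ _ _ w hw m hm := by
    rw [eisNorm_mul] at hN
    have e := h.split q hq (fun t ↦ hN (t.mul_right _)) F w hw m hm
    have f := k.split q hq (fun t ↦ hN (t.mul_left _)) F w hw m hm
    calc _ = (((a : F) + b * w) * (c + d * w)) ^ m := by
          congr 1; push_cast; linear_combination -(b * d : F) * hw
      _ = w ^ ((χ + φ) q).val * (((a : F) + b * (-1 - w)) * (c + d * (-1 - w))) ^ m := by
          rw [mul_pow, e, f, Pi.add_apply, cube_root_pow_val_add hw, mul_pow]; ring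
      _ = _ := by
          congr 2; push_cast; linear_combination (b * d : F) * hw
  inert q hq hN F _ _ _ w hw m hm := by
    rw [eisNorm_mul] at hN
    have e := h.inert q hq (fun t ↦ hN (t.mul_right _)) F w hw m hm
    have f := k.inert q hq (fun t ↦ hN (t.mul_left _)) F w hw m hm
    calc _ = (((a : F) + b * (-1 - w)) * (c + d * (-1 - w))) ^ (m + 1) := by
          congr 1; push_cast; linear_combination -(b * d : F) * hw
      _ = w ^ ((χ + φ) q).val * (((a : F) + b * w) * (c + d * w)) ^ (m + 1) := by
          rw [mul_pow, e, f, Pi.add_apply, cube_root_pow_val_add hw, mul_pow]; ring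
      _ = _ := by
          congr 2; push_cast; linear_combination (b * d : F) * hw

theorem conj {a b : ℤ} {χ : ℤ → ZMod 3} (h : IsCubicSymbol a b χ) :
    IsCubicSymbol (a - b) (-b) (-χ) where
  apply_mul m n hm hn := by
    rw [eisNorm_conj] at hm hn
    simp only [Pi.neg_apply, h.apply_mul m n hm hn]
    ring
  congr m n hmn := by
    rw [eisNorm_conj] at hmn
    rw [Pi.neg_apply, h.congr m n hmn, Pi.neg_apply]
  split q hq hN F _ _ _ w hw m hm := by
    rw [eisNorm_conj] at hN
    have e := h.split q hq hN F (-1 - w) (cube_root_conj hw) m hm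
    rw [cube_root_conj_pow_val hw] at e
    rw [Pi.neg_apply]
    convert e using 2 <;> push_cast <;> ring
  inert q hq hN F _ _ _ w hw m hm := by
    rw [eisNorm_conj] at hN
    have e := h.inert q hq hN F (-1 - w) (cube_root_conj hw) m hm
    rw [cube_root_conj_pow_val hw] at e
    rw [Pi.neg_apply]
    convert e using 2 <;> push_cast <;> ring

theorem intCast (a : ℤ) : IsCubicSymbol a 0 0 where
  apply_mul _ _ _ _ := by simp
  congr _ _ _ := rfl
  split q hq hN F _ _ _ w hw m hm := by simp
  inert q hq hN F _ _ _ w hw m hm := by simp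

theorem apply_one {a b : ℤ} {χ : ℤ → ZMod 3} (h : IsCubicSymbol a b χ) : χ 1 = 0 := by
  have := h.apply_mul 1 1 isCoprime_one_left isCoprime_one_left
  rw [mul_one] at this
  exact left_eq_add.1 this

theorem apply_pow {a b : ℤ} {χ : ℤ → ZMod 3} (h : IsCubicSymbol a b χ) {m : ℤ} {e : ℕ}
    (hm : IsCoprime (m ^ e) (eisNorm a b)) : χ (m ^ e) = e * χ m := by
  induction e with
  | zero => simpa using h.apply_one
  | succ e ih =>
    rw [pow_succ] at hm ⊢
    rw [h.apply_mul _ _ hm.of_mul_left_left hm.of_mul_left_right, ih hm.of_mul_left_left]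
    push_cast
    ring

/-- A cubic symbol vanishes on products of primes at which it vanishes. -/
theorem eq_zero_of_forall_prime {a b : ℤ} {χ : ℤ → ZMod 3} (h : IsCubicSymbol a b χ) {n : ℕ}
    (hn : IsCoprime (n : ℤ) (eisNorm a b)) (hn0 : n ≠ 0)
    (hχ : ∀ q : ℕ, q.Prime → q ∣ n → χ q = 0) : χ n = 0 := by
  induction n using Nat.recOnMul with
  | zero => exact absurd rfl hn0
  | one => exact_mod_cast h.apply_one
  | prime q hq => exact hχ q hq dvd_rfl
  | mul m n hm' hn' =>
    rw [Nat.cast_mul] at hn ⊢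
    rw [h.apply_mul _ _ hn.of_mul_left_left hn.of_mul_left_right,
      hm' hn.of_mul_left_left (left_ne_zero_of_mul hn0) fun q hq hd ↦ hχ q hq (hd.mul_right _),
      hn' hn.of_mul_left_right (right_ne_zero_of_mul hn0) fun q hq hd ↦ hχ q hq (hd.mul_left _),
      add_zero]

end IsCubicSymbol

/-- The ring `ℤ[ω]` of Eisenstein integers. -/
abbrev Eisenstein := QuadraticAlgebra ℤ (-1) (-1)

namespace Eisenstein

open QuadraticAlgebra

/-- Evaluation of an Eisenstein integer at a root `w` of `X ^ 2 + X + 1`. -/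
def eval {F : Type*} [CommRing F] (w : F) (hw : w ^ 2 + w + 1 = 0) : Eisenstein →+* F where
  toFun z := z.re + z.im * w
  map_one' := by simp
  map_zero' := by simp
  map_add' x y := by simp; ring
  map_mul' x y := by simp; linear_combination -(x.im * y.im : F) * hw

theorem eval_apply {F : Type*} [CommRing F] {w : F} (hw : w ^ 2 + w + 1 = 0) (z : Eisenstein) :
    eval w hw z = z.re + z.im * w := rfl

theorem eval_star {F : Type*} [CommRing F] {w : F} (hw : w ^ 2 + w + 1 = 0) (z : Eisenstein) :
    eval w hw (star z) = z.re + z.im * (-1 - w) := by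
  simp [eval_apply]; ring

theorem norm_eq_eisNorm (z : Eisenstein) : z.norm = eisNorm z.re z.im := by
  rw [norm_def, eisNorm]; ring

instance : NoZeroDivisors Eisenstein where
  eq_zero_or_eq_zero_of_mul_eq_zero {x y} h := by
    have key (z : Eisenstein) (hz : z.norm = 0) : z = 0 := by
      rw [norm_eq_eisNorm, eisNorm] at hz
      have h1 : z.re = 0 := by nlinarith [sq_nonneg (2 * z.im - z.re), sq_nonneg z.re]
      have h2 : z.im = 0 := by simpa [h1] using hz
      exact QuadraticAlgebra.ext h1 h2
    have : x.norm * y.norm = 0 := by rw [← map_mul, h, QuadraticAlgebra.norm_zero]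
    exact (mul_eq_zero.1 this).imp (key x) (key y)

instance : IsDomain Eisenstein := NoZeroDivisors.to_isDomain _

theorem omega_sq : (ω : Eisenstein) ^ 2 + ω + 1 = 0 := by
  rw [sq, omega_mul_omega_eq_mk]
  ext <;> simp

theorem isPrimitiveRoot_omega : IsPrimitiveRoot (ω : Eisenstein) 3 := by
  have h : orderOf (ω : Eisenstein) = 3 :=
    orderOf_eq_prime (cube_root_pow_three omega_sq) fun h ↦ by
      simpa using congrArg QuadraticAlgebra.im h
  exact h ▸ IsPrimitiveRoot.orderOf _

theorem eval_omega {F : Type*} [CommRing F] {w : F} (hw : w ^ 2 + w + 1 = 0) :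
    eval w hw ω = w := by
  simp [eval_apply]

section Character

variable {l : ℕ} [Fact l.Prime] {X : MulChar (ZMod l) Eisenstein}

theorem exists_eq_omega_pow (h3 : X ^ 3 = 1) {x : ZMod l} (hx : x ≠ 0) :
    ∃ j : ZMod 3, X x = ω ^ j.val := by
  obtain ⟨k, hk, h⟩ := MulChar.exists_apply_eq_pow h3 isPrimitiveRoot_omega hx
  exact ⟨k, by rw [h, ZMod.val_natCast, Nat.mod_eq_of_lt hk]⟩

theorem ringHomComp_ne_one (h3 : X ^ 3 = 1) (h1 : X ≠ 1) {F : Type*} [Field F]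
    (hF : (3 : F) ≠ 0) {w : F} (hw : w ^ 2 + w + 1 = 0) : X.ringHomComp (eval w hw) ≠ 1 := by
  intro h
  refine h1 (MulChar.ext fun u ↦ ?_)
  obtain ⟨j, hj⟩ := exists_eq_omega_pow h3 u.ne_zero
  have hu : X.ringHomComp (eval w hw) u = 1 := by rw [h, MulChar.one_apply_coe]
  rw [MulChar.ringHomComp_apply, hj, map_pow, eval_omega] at hu
  have hj0 : j = 0 := cube_root_pow_val_injective hF hw (by simpa using hu)
  rw [hj, hj0, MulChar.one_apply_coe, ZMod.val_zero, pow_zero]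

theorem inv_eq_ringHomComp_star (h3 : X ^ 3 = 1) :
    X⁻¹ = X.ringHomComp (starRingEnd Eisenstein) := by
  refine MulChar.ext fun u ↦ ?_
  obtain ⟨j, hj⟩ := exists_eq_omega_pow h3 u.ne_zero
  have hu : (X⁻¹ * X) u = 1 := by rw [inv_mul_cancel, MulChar.one_apply_coe]
  rw [MulChar.mul_apply] at hu
  have h0 : X u ≠ 0 := right_ne_zero_of_mul (hu ▸ one_ne_zero)
  refine mul_right_cancel₀ h0 (hu.trans ?_)
  rw [MulChar.ringHomComp_apply, hj, map_pow, ← mul_pow]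
  have : (starRingEnd Eisenstein) ω * ω = 1 := by
    rw [starRingEnd_apply]; ext <;> simp
  rw [this, one_pow]

theorem jacobiSum_inv (h3 : X ^ 3 = 1) : jacobiSum X⁻¹ X⁻¹ = star (jacobiSum X X) := by
  rw [inv_eq_ringHomComp_star h3, jacobiSum_ringHomComp, starRingEnd_apply]

theorem norm_jacobiSum (h3 : X ^ 3 = 1) (h1 : X ≠ 1) :
    eisNorm (jacobiSum X X).re (jacobiSum X X).im = l := by
  obtain ⟨w, hw⟩ : ∃ w : ℂ, w ^ 2 + w + 1 = 0 := by
    obtain ⟨w, hw⟩ := HasEnoughRootsOfUnity.exists_primitiveRoot ℂ 3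
    refine ⟨w, ?_⟩
    have h := hw.geom_sum_eq_zero (by norm_num)
    simp only [Finset.sum_range_succ, Finset.sum_range_zero] at h
    linear_combination h
  set Y := X.ringHomComp (eval w hw) with hYdef
  have hY : Y ≠ 1 := ringHomComp_ne_one h3 h1 (by norm_num) hw
  have hY3 : Y ^ 3 = 1 := by rw [hYdef, MulChar.ringHomComp_pow, h3, MulChar.ringHomComp_one]
  have hYY : Y * Y ≠ 1 := by
    rw [← sq, sq_eq_inv_of_pow_three_eq_one hY3]
    exact inv_ne_one.2 hY
  have hc : ringChar ℂ ≠ ringChar (ZMod l) := by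
    rw [ZMod.ringChar_zmod_n, ringChar.eq_zero]
    exact (Fact.out : l.Prime).ne_zero.symm
  have h := jacobiSum_mul_jacobiSum_inv hc hY hY hYY
  rw [hYdef, MulChar.ringHomComp_inv, jacobiSum_ringHomComp, jacobiSum_ringHomComp,
    jacobiSum_inv h3, ← map_mul, ← algebraMap_norm_eq_mul_star, ZMod.card,
    norm_eq_eisNorm, eq_intCast (algebraMap ℤ Eisenstein), map_intCast] at h
  exact_mod_cast h

theorem jacobiSum_primary (h3 : X ^ 3 = 1) (hl : 3 ∣ l - 1) :
    3 ∣ (jacobiSum X X).re + 1 ∧ 3 ∣ (jacobiSum X X).im := by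
  obtain ⟨z, -, hz⟩ := exists_jacobiSum_eq_neg_one_add (by norm_num) h3 h3
    (by rwa [ZMod.card]) isPrimitiveRoot_omega
  have hsq : (ω - 1 : Eisenstein) ^ 2 = -3 * ω := by linear_combination omega_sq
  rw [hz, hsq]
  constructor
  · refine ⟨z.im, ?_⟩
    simp
    ring
  · refine ⟨z.im - z.re, ?_⟩
    simp
    ring

theorem isCubicSymbol_jacobiSum (h3 : X ^ 3 = 1) (h1 : X ≠ 1) :
    ∃ χ, IsCubicSymbol (jacobiSum X X).re (jacobiSum X X).im χ := by
  have hχ (x : ZMod l) : ∃ j : ZMod 3, x ≠ 0 → X x = ω ^ j.val := by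
    by_cases hx : x = 0
    · exact ⟨0, fun h ↦ absurd hx h⟩
    · exact (exists_eq_omega_pow h3 hx).imp fun _ h _ ↦ h
  choose χ hχ using hχ
  have hl : l.Prime := Fact.out
  have hcop {m : ℤ} (hm : IsCoprime m (l : ℤ)) : (m : ZMod l) ≠ 0 := by
    rw [Ne, ZMod.intCast_zmod_eq_zero_iff_dvd]
    exact fun h ↦ (Nat.prime_iff_prime_int.1 hl).not_isUnit (hm.isUnit_of_dvd' h dvd_rfl)
  have hpow {q : ℕ} (hq : q.Prime) (hql : ¬ (q : ℤ) ∣ l) (F : Type) [Field F] [IsAlgClosed F]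
      [CharP F q] (w : F) (hw : w ^ 2 + w + 1 = 0) (hq3 : q ≠ 3) (m : ℕ) :=
    have : Fact q.Prime := ⟨hq⟩
    have hlq : l ≠ q := by rintro rfl; exact hql dvd_rfl
    have h3F : (3 : F) ≠ 0 := fun h ↦ hq3 <|
      (Nat.prime_dvd_prime_iff_eq hq Nat.prime_three).1
        ((CharP.cast_eq_zero_iff F q 3).1 (by exact_mod_cast h))
    jacobiSum_pow_of_cubic hlq
      (by rw [MulChar.ringHomComp_pow, h3, MulChar.ringHomComp_one])
      (ringHomComp_ne_one h3 h1 h3F hw) m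
  have hval {q : ℕ} (hq : q.Prime) (hql : ¬ (q : ℤ) ∣ l) : X (q : ZMod l) = ω ^ (χ q).val := by
    refine hχ _ fun h ↦ hql ?_
    rw [(Nat.prime_dvd_prime_iff_eq hl hq).1 ((ZMod.natCast_eq_zero_iff q l).1 h)]
  refine ⟨fun n ↦ χ n, ?_, ?_, ?_, ?_⟩
  · rw [norm_jacobiSum h3 h1]
    intro m n hm hn
    refine cube_root_pow_val_injective (F := Eisenstein) (by norm_num) omega_sq ?_
    rw [cube_root_pow_val_add omega_sq, ← hχ _ (hcop hm), ← hχ _ (hcop hn), ← map_mul,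
      ← Int.cast_mul, hχ _ (hcop (hm.mul_left hn))]
  · rw [norm_jacobiSum h3 h1]
    intro m n h
    congr 1
    exact ((ZMod.intCast_eq_intCast_iff_dvd_sub n m l).2 h).symm
  · rw [norm_jacobiSum h3 h1]
    intro q hq hql F _ _ _ w hw m hm
    have h := (hpow hq hql F w hw (by omega) m).1 hm
    rwa [MulChar.ringHomComp_inv, jacobiSum_ringHomComp, jacobiSum_ringHomComp,
      jacobiSum_inv h3, MulChar.ringHomComp_apply, hval hq hql, map_pow, eval_omega, eval_star,
      eval_apply, ← Int.cast_natCast (R := ZMod l)] at h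
  · rw [norm_jacobiSum h3 h1]
    intro q hq hql F _ _ _ w hw m hm
    have h := (hpow hq hql F w hw (by omega) m).2 hm
    rwa [MulChar.ringHomComp_inv, jacobiSum_ringHomComp, jacobiSum_ringHomComp,
      jacobiSum_inv h3, MulChar.ringHomComp_apply, hval hq hql, map_pow, eval_omega, eval_star,
      eval_apply, ← Int.cast_natCast (R := ZMod l)] at h

end Character

end Eisenstein

theorem exists_isCubicSymbol_of_prime {l : ℕ} (hl : l.Prime) (hl3 : 3 ∣ l - 1) :
    ∃ (c d : ℤ) (χ : ℤ → ZMod 3), eisNorm c d = l ∧ 3 ∣ c + 1 ∧ 3 ∣ d ∧ IsCubicSymbol c d χ := by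
  have : Fact l.Prime := ⟨hl⟩
  obtain ⟨X, hX⟩ := MulChar.exists_mulChar_orderOf (ZMod l) (by rwa [ZMod.card])
    Eisenstein.isPrimitiveRoot_omega
  have h3 : X ^ 3 = 1 := hX ▸ pow_orderOf_eq_one X
  have h1 : X ≠ 1 := by
    rintro rfl
    simp at hX
  obtain ⟨χ, hχ⟩ := Eisenstein.isCubicSymbol_jacobiSum h3 h1
  exact ⟨_, _, χ, Eisenstein.norm_jacobiSum h3 h1, (Eisenstein.jacobiSum_primary h3 hl3).1,
    (Eisenstein.jacobiSum_primary h3 hl3).2, hχ⟩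

theorem dvd_of_dvd_eisNorm {l : ℕ} (hl : l.Prime) (hl3 : l % 3 = 2) {a b : ℤ}
    (h : (l : ℤ) ∣ eisNorm a b) : (l : ℤ) ∣ a ∧ (l : ℤ) ∣ b := by
  have : Fact l.Prime := ⟨hl⟩
  have hb : (l : ℤ) ∣ b := by
    by_contra hb
    have hb0 : (b : ZMod l) ≠ 0 := by rwa [Ne, ZMod.intCast_zmod_eq_zero_iff_dvd]
    have hN : (a : ZMod l) ^ 2 - a * b + b ^ 2 = 0 := by
      have := (ZMod.intCast_zmod_eq_zero_iff_dvd _ l).2 h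
      rw [eisNorm] at this
      exact_mod_cast this
    have hr : (-(a : ZMod l) / b) ^ 2 + (-(a : ZMod l) / b) + 1 = 0 := by
      field_simp
      linear_combination hN
    have h1 : -(a : ZMod l) / b ≠ 1 := by
      intro h1
      rw [h1] at hr
      have h3 : ((3 : ℕ) : ZMod l) = 0 := by push_cast; linear_combination hr
      have := (Nat.prime_dvd_prime_iff_eq hl Nat.prime_three).1
        ((ZMod.natCast_eq_zero_iff 3 l).1 h3)
      omega
    have ho := orderOf_eq_prime (cube_root_pow_three hr) h1
    have hr0 : -(a : ZMod l) / b ≠ 0 := by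
      intro h0
      simp [h0] at hr
    have := ho ▸ orderOf_dvd_of_pow_eq_one (ZMod.pow_card_sub_one_eq_one hr0)
    have := hl.two_le
    omega
  refine ⟨(Nat.prime_iff_prime_int.1 hl).dvd_of_dvd_pow (n := 2) ?_, hb⟩
  have : a ^ 2 = eisNorm a b + b * (a - b) := by rw [eisNorm]; ring
  rw [this]
  exact dvd_add h (hb.mul_right _)

theorem exists_eq_mul_of_dvd {l : ℕ} (hl : l.Prime) {a b c d : ℤ} (hc : eisNorm c d = l)
    (h : (l : ℤ) ∣ eisNorm a b) (hv : (l : ℤ) ∣ b * c - a * d) :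
    ∃ e f, a = c * e - d * f ∧ b = c * f + d * e - d * f := by
  have hu : (l : ℤ) ∣ a * (c - d) + b * d := by
    refine (Nat.prime_iff_prime_int.1 hl).dvd_of_dvd_pow (n := 2) ?_
    have : (a * (c - d) + b * d) ^ 2 = eisNorm c d * eisNorm a b
        + (b * c - a * d) * ((a * (c - d) + b * d) - (b * c - a * d)) := by
      simp only [eisNorm]; ring
    rw [this]
    exact dvd_add (h.mul_left _) (hv.mul_right _)
  obtain ⟨f, hf⟩ := hv
  obtain ⟨e, he⟩ := hu
  have hl0 : (l : ℤ) ≠ 0 := by exact_mod_cast hl.ne_zero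
  rw [eisNorm] at hc
  refine ⟨e, f, mul_left_cancel₀ hl0 ?_, mul_left_cancel₀ hl0 ?_⟩
  · linear_combination c * he - d * hf - a * hc
  · linear_combination c * hf + d * he - d * hf - b * hc

theorem exists_eq_mul_or_conj_mul {l : ℕ} (hl : l.Prime) {a b c d : ℤ} (hc : eisNorm c d = l)
    (h : (l : ℤ) ∣ eisNorm a b) :
    (∃ e f, a = c * e - d * f ∧ b = c * f + d * e - d * f) ∨
      ∃ e f, a = (c - d) * e - (-d) * f ∧ b = (c - d) * f + (-d) * e - (-d) * f := by
  have hp : (l : ℤ) ∣ (b * c - a * d) * (b * (c - d) - a * (-d)) := by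
    have : (b * c - a * d) * (b * (c - d) - a * (-d))
        = b ^ 2 * eisNorm c d - d ^ 2 * eisNorm a b := by
      simp only [eisNorm]; ring
    rw [this, hc]
    exact dvd_sub (dvd_mul_left _ _) (h.mul_left _)
  refine ((Nat.prime_iff_prime_int.1 hl).dvd_or_dvd hp).imp ?_ ?_
  · exact exists_eq_mul_of_dvd hl hc h
  · exact exists_eq_mul_of_dvd hl ((eisNorm_conj c d).trans hc) h

theorem eisNorm_pos {a b : ℤ} (ha : ¬ 3 ∣ a) : 0 < eisNorm a b := by
  have : a ≠ 0 := fun h ↦ ha (h ▸ dvd_zero 3)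
  have := sq_pos_of_ne_zero this
  rw [eisNorm]
  nlinarith [sq_nonneg (2 * b - a)]

/-- Cubic reciprocity between Eisenstein integers congruent to `1` or `-1` modulo `3` and
rational primes. -/
theorem exists_isCubicSymbol (a b : ℤ) (ha : ¬ 3 ∣ a) (hb : 3 ∣ b) :
    ∃ χ, IsCubicSymbol a b χ := by
  induction hn : (eisNorm a b).natAbs using Nat.strong_induction_on generalizing a b with
  | _ n ih =>
  by_cases hn1 : n = 1
  · have hb0 : b = 0 := by
      obtain ⟨c, rfl⟩ := hb
      have := eisNorm_pos (b := 3 * c) ha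
      have h1 : eisNorm a (3 * c) = 1 := by omega
      rw [eisNorm] at h1
      have hc : c ^ 2 < 1 := by nlinarith [sq_nonneg (2 * a - 3 * c)]
      have : c = 0 := by
        by_contra h0
        have := sq_pos_of_ne_zero h0
        omega
      simp [this]
    exact ⟨0, hb0 ▸ IsCubicSymbol.intCast a⟩
  have hpos := eisNorm_pos (b := b) ha
  have hl : n.minFac.Prime := Nat.minFac_prime hn1
  have hlN : (n.minFac : ℤ) ∣ eisNorm a b :=
    Int.natCast_dvd.2 (hn ▸ n.minFac_dvd)
  set l := n.minFac
  have hlZ := Nat.prime_iff_prime_int.1 hl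
  have hstep (c d e f : ℤ) (hcd : 1 < eisNorm c d) (hd : 3 ∣ d) (hc : ¬ 3 ∣ c)
      (hcs : ∃ χ, IsCubicSymbol c d χ) (hae : a = c * e - d * f)
      (hbf : b = c * f + d * e - d * f) : ∃ χ, IsCubicSymbol a b χ := by
    have h3 : Prime (3 : ℤ) := Int.prime_three
    have he : ¬ 3 ∣ e := fun h ↦ ha (hae ▸ dvd_sub (h.mul_left _) (hd.mul_right _))
    have hf : 3 ∣ f := by
      have : c * f = b - d * (e - f) := by rw [hbf]; ring
      exact (h3.dvd_or_dvd (this ▸ dvd_sub hb (hd.mul_right _))).resolve_left hc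
    have hlt : (eisNorm e f).natAbs < n := by
      have h1 := eisNorm_mul c d e f
      rw [← hae, ← hbf] at h1
      have := eisNorm_pos (b := f) he
      rw [← hn]
      apply Int.natAbs_lt_natAbs_of_nonneg_of_lt this.le
      nlinarith
    obtain ⟨χ, hχ⟩ := hcs
    obtain ⟨φ, hφ⟩ := ih _ hlt e f he hf rfl
    exact ⟨χ + φ, by rw [hae, hbf]; exact hχ.mul hφ⟩
  have hl2 := hl.two_le
  have hcases : l % 3 = 0 ∨ l % 3 = 1 ∨ l % 3 = 2 := by omega
  rcases hcases with h | h | h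
  · have h3 : l = 3 := ((Nat.prime_dvd_prime_iff_eq Nat.prime_three hl).1
      (Nat.dvd_of_mod_eq_zero h)).symm
    refine absurd (Int.prime_three.dvd_of_dvd_pow (n := 2) ?_) ha
    have : a ^ 2 = eisNorm a b + b * (a - b) := by rw [eisNorm]; ring
    rw [this]
    exact dvd_add (by simpa [h3] using hlN) (hb.mul_right _)
  · obtain ⟨c, d, χ, hcl, hc, hd, hχ⟩ := exists_isCubicSymbol_of_prime hl (by omega)
    rcases exists_eq_mul_or_conj_mul hl hcl hlN with ⟨e, f, he, hf⟩ | ⟨e, f, he, hf⟩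
    · exact hstep c d e f (by omega) hd (by omega) ⟨χ, hχ⟩ he hf
    · exact hstep (c - d) (-d) e f (by rw [eisNorm_conj]; omega) (by omega) (by omega)
        ⟨-χ, hχ.conj⟩ he hf
  · obtain ⟨⟨e, he⟩, ⟨f, hf⟩⟩ := dvd_of_dvd_eisNorm hl h hlN
    refine hstep l 0 e f ?_ (by omega) (by omega) ⟨0, .intCast _⟩ (by rw [he]; ring)
      (by rw [hf]; ring)
    simp only [eisNorm]
    nlinarith

section PrincipalForm

variable {X Y : ℤ} {n : ℕ} {χ : ℤ → ZMod 3}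

theorem exists_sq_add_self_add_one_eq_zero (F : Type*) [Field F] [IsAlgClosed F] :
    ∃ w : F, w ^ 2 + w + 1 = 0 := by
  obtain ⟨w, hw⟩ := IsAlgClosed.exists_root (Polynomial.cyclotomic 3 F)
    (by rw [Polynomial.degree_cyclotomic, Nat.totient_prime Nat.prime_three]; norm_num)
  exact ⟨w, by simpa [Polynomial.cyclotomic_three] using hw⟩

theorem natCast_ne_zero_of_prime_ne (F : Type*) [Field F] {q r : ℕ} [CharP F q] (hq : q.Prime)
    (hr : r.Prime) (h : q ≠ r) : (r : F) ≠ 0 := fun t ↦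
  h ((Nat.prime_dvd_prime_iff_eq hq hr).1 ((CharP.cast_eq_zero_iff F q r).1 t))

theorem intCast_eisNorm {F : Type*} [CommRing F] {w : F} (hw : w ^ 2 + w + 1 = 0) (a b : ℤ) :
    (eisNorm a b : F) = (a + b * w) * (a + b * (-1 - w)) := by
  rw [eisNorm]; push_cast; linear_combination (b ^ 2 : F) * hw

theorem eisNorm_principal (hn : (n : ℤ) = X ^ 2 + X * Y + 6 * Y ^ 2) :
    eisNorm (3 * X + 14 * Y) (3 * (2 * X + Y)) = 27 * n + Y ^ 2 := by
  rw [hn, eisNorm]; ring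

theorem isCoprime_principal (hn : (n : ℤ) = X ^ 2 + X * Y + 6 * Y ^ 2) (hXY : IsCoprime X Y) :
    IsCoprime (n : ℤ) Y := by
  rw [hn, show X ^ 2 + X * Y + 6 * Y ^ 2 = X ^ 2 + Y * (X + 6 * Y) by ring]
  exact hXY.pow_left.add_mul_left_left _

theorem isCoprime_eisNorm_principal (hn : (n : ℤ) = X ^ 2 + X * Y + 6 * Y ^ 2)
    (hXY : IsCoprime X Y) : IsCoprime (n : ℤ) (eisNorm (3 * X + 14 * Y) (3 * (2 * X + Y))) := by
  rw [eisNorm_principal hn, add_comm, mul_comm]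
  exact (isCoprime_principal hn hXY).pow_right.add_mul_left_right _

theorem isCoprime_three_of_not_dvd {Y : ℤ} (h : ¬ 3 ∣ Y) : IsCoprime 3 Y :=
  (Int.prime_three.coprime_iff_not_dvd).2 h

theorem IsCubicSymbol.eq_zero_of_dvd_of_isAlgClosed
    (h : IsCubicSymbol (3 * X + 14 * Y) (3 * (2 * X + Y)) χ)
    {q : ℕ} (hq : q.Prime) (hqY : (q : ℤ) ∣ Y) (hq3 : q ≠ 3)
    (hqN : ¬ (q : ℤ) ∣ eisNorm (3 * X + 14 * Y) (3 * (2 * X + Y)))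
    (F : Type) [Field F] [IsAlgClosed F] [CharP F q] : χ q = 0 := by
  have hY : (Y : F) = 0 := (CharP.intCast_eq_zero_iff F q Y).2 hqY
  have h3 : (3 : F) ≠ 0 := mod_cast natCast_ne_zero_of_prime_ne F hq Nat.prime_three hq3
  obtain ⟨w, hw⟩ := exists_sq_add_self_add_one_eq_zero F
  have hN0 : (eisNorm (3 * X + 14 * Y) (3 * (2 * X + Y)) : F) ≠ 0 := fun t ↦
    hqN ((CharP.intCast_eq_zero_iff F q _).1 t)
  rw [intCast_eisNorm hw] at hN0
  have hs := h.split q hq hqN F w hw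
  have hi := h.inert q hq hqN F w hw
  have hA : ((3 * X + 14 * Y : ℤ) : F) + (3 * (2 * X + Y) : ℤ) * (-1 - w)
      = -(((3 * X + 14 * Y : ℤ) : F) + (3 * (2 * X + Y) : ℤ) * w) := by
    push_cast; linear_combination 25 * hY
  rw [hA] at hN0 hs hi
  set A : F := ((3 * X + 14 * Y : ℤ) : F) + (3 * (2 * X + Y) : ℤ) * w
  have hA0 : A ≠ 0 := left_ne_zero_of_mul hN0
  have hneg : ∀ m, (q = 3 * m + 1 ∨ q = 3 * m - 1) → (-A) ^ m = A ^ m := fun m hm ↦ by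
    rcases hq.eq_two_or_odd' with rfl | ho
    · rw [CharTwo.neg_eq]
    · refine Even.neg_pow ?_ A
      grind
  refine cube_root_pow_val_injective h3 hw ?_
  rw [ZMod.val_zero, pow_zero]
  have : q % 3 = 1 ∨ q % 3 = 2 := by
    have : ¬ 3 ∣ q := fun t ↦ hq3 ((Nat.prime_dvd_prime_iff_eq Nat.prime_three hq).1 t).symm
    omega
  rcases this with hm | hm
  · have e := hs (q / 3) (by omega)
    rw [hneg _ (by omega)] at e
    exact (right_eq_mul₀ (pow_ne_zero _ hA0)).1 e
  · have e := hi (q / 3) (by omega)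
    rw [hneg _ (by omega)] at e
    exact (right_eq_mul₀ (pow_ne_zero _ hA0)).1 e

/-- The symbol of `3 * X + 14 * Y + 3 * (2 * X + Y) * ω` vanishes at the primes dividing `Y`,
as there it is, up to a rational factor, the symbol of `1 + 2 * ω`. -/
theorem IsCubicSymbol.eq_zero_of_dvd
    (h : IsCubicSymbol (3 * X + 14 * Y) (3 * (2 * X + Y)) χ)
    {q : ℕ} (hq : q.Prime) (hqY : (q : ℤ) ∣ Y) (hq3 : q ≠ 3)
    (hqN : ¬ (q : ℤ) ∣ eisNorm (3 * X + 14 * Y) (3 * (2 * X + Y))) : χ q = 0 :=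
  have : Fact q.Prime := ⟨hq⟩
  h.eq_zero_of_dvd_of_isAlgClosed hq hqY hq3 hqN (AlgebraicClosure (ZMod q))

/-- The key reciprocity: the cubic symbol attached to `X` and `Y` vanishes at
`X ^ 2 + X * Y + 6 * Y ^ 2`. -/
theorem IsCubicSymbol.apply_principal_eq_zero
    (h : IsCubicSymbol (3 * X + 14 * Y) (3 * (2 * X + Y)) χ)
    (hn : (n : ℤ) = X ^ 2 + X * Y + 6 * Y ^ 2) (hXY : IsCoprime X Y) (h3Y : ¬ 3 ∣ Y) :
    χ n = 0 := by
  have hN := eisNorm_principal hn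
  have hnY := isCoprime_principal hn hXY
  have c3 : IsCoprime 3 (eisNorm (3 * X + 14 * Y) (3 * (2 * X + Y))) := by
    rw [hN, show (27 * n + Y ^ 2 : ℤ) = Y ^ 2 + 3 * (9 * n) by ring]
    exact (isCoprime_three_of_not_dvd h3Y).pow_right.add_mul_left_right _
  have cn := isCoprime_eisNorm_principal hn hXY
  have cY : IsCoprime Y (eisNorm (3 * X + 14 * Y) (3 * (2 * X + Y))) := by
    rw [hN, sq]
    exact (IsCoprime.mul_right
      (by simpa using (isCoprime_three_of_not_dvd h3Y).symm.pow_right (n := 3))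
      hnY.symm).add_mul_left_right _
  have hY : χ Y.natAbs = 0 := by
    refine h.eq_zero_of_forall_prime (by simpa using cY.abs_left) (by
      rintro t; simp [Int.natAbs_eq_zero.1 t] at h3Y) fun q hq hqY ↦ ?_
    have hqY' : (q : ℤ) ∣ Y := Int.natCast_dvd.2 hqY
    refine h.eq_zero_of_dvd hq hqY' ?_ fun t ↦ ?_
    · rintro rfl; exact h3Y (by exact_mod_cast hqY')
    · exact (Nat.prime_iff_prime_int.1 hq).not_isUnit (cY.isUnit_of_dvd' hqY' t)
  have hm1 : χ (-1) = 0 := by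
    have := h.apply_mul (-1) (-1) isCoprime_one_left.neg_left isCoprime_one_left.neg_left
    rw [neg_one_mul, neg_neg, h.apply_one] at this
    revert this
    generalize χ (-1) = c
    revert c; decide
  have e1 : χ (3 * (3 * (3 * n))) = χ n := by
    rw [h.apply_mul _ _ c3 (c3.mul_left (c3.mul_left cn)), h.apply_mul _ _ c3 (c3.mul_left cn),
      h.apply_mul _ _ c3 cn]
    generalize χ 3 = c
    generalize χ n = d
    revert c d; decide
  have e2 : χ (-1 * (Y.natAbs * Y.natAbs)) = 0 := by
    have c : IsCoprime (Y.natAbs : ℤ) (eisNorm (3 * X + 14 * Y) (3 * (2 * X + Y))) := by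
      simpa using cY.abs_left
    rw [h.apply_mul _ _ isCoprime_one_left.neg_left (c.mul_left c), h.apply_mul _ _ c c, hY, hm1]
    rfl
  rw [← e1, ← e2]
  refine h.congr _ _ ?_
  rw [hN, Int.natAbs_mul_self']
  exact dvd_of_eq (by ring)

end PrincipalForm

section ChooseSum

theorem choose_succ_three_mul (k : ℕ) :
    (3 * (k + 1)).choose (k + 1) * ((2 * k + 1) * (2 * k + 2)) =
      (3 * k).choose k * (3 * (3 * k + 1) * (3 * k + 2)) := by
  have h1 := Nat.add_one_mul_choose_eq (3 * k + 2) k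
  have h2 := Nat.choose_mul_succ_eq (3 * k) k
  have h3 := Nat.choose_mul_succ_eq (3 * k + 1) k
  rw [show 3 * k + 1 - k = 2 * k + 1 by omega] at h2
  rw [show 3 * k + 1 + 1 - k = 2 * k + 2 by omega] at h3
  refine Nat.eq_of_mul_eq_mul_right (Nat.add_one_pos k) ?_
  simp only [Nat.mul_add, mul_one, add_assoc, Nat.reduceAdd] at *
  zify at *
  linear_combination -(2 * k + 1) * (2 * k + 2) * h1 -(3 * k + 3) * (2 * k + 1) * h3
    - (3 * k + 3) * (3 * k + 2) * h2

theorem choose_succ_add_two_mul (n k : ℕ) :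
    (n + (k + 1)).choose (2 * (k + 1)) * ((2 * k + 1) * (2 * k + 2)) =
      (n + k).choose (2 * k) * ((n + k + 1) * (n - k)) := by
  have h1 := Nat.add_one_mul_choose_eq (n + k) (2 * k + 1)
  have h2 := Nat.choose_succ_right_eq (n + k) (2 * k)
  rw [show n + k - 2 * k = n - k by omega] at h2
  generalize n - k = d at *
  simp only [Nat.mul_add, mul_one, add_assoc, Nat.reduceAdd] at *
  zify at *
  linear_combination -(2 * k + 1) * h1 + (n + (k + 1)) * h2

theorem choose_three_mul_eq {F : Type*} [Field F] {p n : ℕ} [CharP F p]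
    (hp : p = 3 * n + 1 ∨ p = 3 * n + 2) {k : ℕ} (hk : k ≤ n) :
    ((3 * k).choose k : F) = (n + k).choose (2 * k) * (-27) ^ k := by
  induction k with
  | zero => simp
  | succ k ih =>
    have h0 (i : ℕ) (hi : 0 < i) (hip : i < p) : (i : F) ≠ 0 := fun t ↦
      (Nat.le_of_dvd hi ((CharP.cast_eq_zero_iff F p i).1 t)).not_gt hip
    have hD : ((2 * k + 1 : ℕ) : F) * (2 * k + 2 : ℕ) ≠ 0 :=
      mul_ne_zero (h0 _ (by omega) (by omega)) (h0 _ (by omega) (by omega))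
    have h1 := congrArg (Nat.cast (R := F)) (choose_succ_three_mul k)
    have h2 := congrArg (Nat.cast (R := F)) (choose_succ_add_two_mul n k)
    have h3 : (3 * n + 1 : F) * (3 * n + 2) = 0 := by
      have := CharP.cast_eq_zero F p
      rcases hp with rfl | rfl <;> push_cast at this <;> rw [this] <;> ring
    rw [Nat.cast_mul, Nat.cast_mul, Nat.cast_mul, Nat.cast_mul, Nat.cast_sub (by omega)] at h2
    rw [Nat.cast_mul, Nat.cast_mul, Nat.cast_mul, ih (by omega)] at h1
    refine mul_right_cancel₀ hD (h1.trans ?_)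
    push_cast at h2 ⊢
    rw [pow_succ]
    linear_combination 27 * (-27) ^ k * h2
      + 3 * (n + k).choose (2 * k) * (-27) ^ k * h3

variable {R : Type*} [CommRing R]

theorem sum_choose_two_mul_succ (n : ℕ) (x : R) :
    ∑ k ∈ Finset.range (n + 2), ((n + 1 + k).choose (2 * k) : R) * x ^ k =
      ∑ k ∈ Finset.range (n + 1), ((n + k).choose (2 * k) : R) * x ^ k +
        x * ∑ k ∈ Finset.range (n + 1), ((n + k + 1).choose (2 * k + 1) : R) * x ^ k := by
  have h : ∑ k ∈ Finset.range (n + 1), ((n + k).choose (2 * k) : R) * x ^ k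
      = ∑ k ∈ Finset.range (n + 2), ((n + k).choose (2 * k) : R) * x ^ k := by
    rw [Finset.sum_range_succ _ (n + 1), Nat.choose_eq_zero_of_lt (by omega)]
    simp
  rw [h, Finset.sum_range_succ', Finset.sum_range_succ' _ (n + 1), Finset.mul_sum,
    add_right_comm (Finset.sum _ _), ← Finset.sum_add_distrib]
  congr 1
  · refine Finset.sum_congr rfl fun k _ ↦ ?_
    rw [show n + 1 + (k + 1) = n + k + 1 + 1 by ring, show 2 * (k + 1) = 2 * k + 1 + 1 by ring,
      Nat.choose_succ_succ', ← add_assoc n k 1]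
    push_cast
    ring
  · simp

theorem sum_choose_two_mul_add_one_succ (n : ℕ) (x : R) :
    ∑ k ∈ Finset.range (n + 2), ((n + 1 + k + 1).choose (2 * k + 1) : R) * x ^ k =
      ∑ k ∈ Finset.range (n + 1), ((n + k + 1).choose (2 * k + 1) : R) * x ^ k +
        ∑ k ∈ Finset.range (n + 2), ((n + 1 + k).choose (2 * k) : R) * x ^ k := by
  have h : ∑ k ∈ Finset.range (n + 1), ((n + k + 1).choose (2 * k + 1) : R) * x ^ k
      = ∑ k ∈ Finset.range (n + 2), ((n + k + 1).choose (2 * k + 1) : R) * x ^ k := by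
    rw [Finset.sum_range_succ _ (n + 1), Nat.choose_eq_zero_of_lt (by omega)]
    simp
  rw [h, ← Finset.sum_add_distrib]
  refine Finset.sum_congr rfl fun k _ ↦ ?_
  rw [Nat.choose_succ_succ', add_right_comm n 1 k]
  push_cast
  ring

/-- The sum is a Chebyshev polynomial of the fourth kind. -/
theorem sum_choose_two_mul_mul_add {u v : R} (huv : u * v = 1) (n : ℕ) :
    (∑ k ∈ Finset.range (n + 1), ((n + k).choose (2 * k) : R) * ((u - v) ^ 2) ^ k) * (u + v) =
        u ^ (2 * n + 1) + v ^ (2 * n + 1) ∧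
      (∑ k ∈ Finset.range (n + 1), ((n + k + 1).choose (2 * k + 1) : R) * ((u - v) ^ 2) ^ k) *
          (u ^ 2 - v ^ 2) = u ^ (2 * n + 2) - v ^ (2 * n + 2) := by
  induction n with
  | zero => simp
  | succ n ih =>
    obtain ⟨hP, hQ⟩ := ih
    have hP' := sum_choose_two_mul_succ n ((u - v) ^ 2)
    have hQ' := sum_choose_two_mul_add_one_succ n ((u - v) ^ 2)
    have e : (∑ k ∈ Finset.range (n + 2), ((n + 1 + k).choose (2 * k) : R) * ((u - v) ^ 2) ^ k) *
        (u + v) = u ^ (2 * (n + 1) + 1) + v ^ (2 * (n + 1) + 1) := by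
      linear_combination (u + v) * hP' + hP + (u - v) * hQ
        - (u ^ (2 * n + 1) + v ^ (2 * n + 1)) * huv
    refine ⟨e, ?_⟩
    linear_combination (u ^ 2 - v ^ 2) * hQ' + hQ + (u - v) * e
      - (u ^ (2 * n + 2) - v ^ (2 * n + 2)) * huv

theorem sum_choose_three_mul {F : Type*} [Field F] {p : ℕ} [CharP F p] (hp : p % 3 ≠ 0) {u v : F}
    (huv : u * v = 1) (h27 : (u - v) ^ 2 = -27) :
    (∑ k ∈ Finset.range (p / 3 + 1), ((3 * k).choose k : F)) * (u + v) =
      u ^ (2 * (p / 3) + 1) + v ^ (2 * (p / 3) + 1) := by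
  rw [← (sum_choose_two_mul_mul_add huv _).1, h27]
  congr 1
  refine Finset.sum_congr rfl fun k hk ↦ choose_three_mul_eq (p := p) (by omega) ?_
  exact Nat.lt_succ_iff.1 (Finset.mem_range.1 hk)

end ChooseSum

section SumValue

variable {X Y : ℤ} {χ : ℤ → ZMod 3} {p : ℕ} [Fact p.Prime]

theorem IsCubicSymbol.sum_choose_mul (hp : 3 < p)
    (h : IsCubicSymbol (3 * X + 14 * Y) (3 * (2 * X + Y)) χ)
    (hpN : ¬ (p : ℤ) ∣ eisNorm (3 * X + 14 * Y) (3 * (2 * X + Y)))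
    (F : Type) [Field F] [IsAlgClosed F] [CharP F p] (hY : (Y : F) ≠ 0)
    (hXY : (X : F) ^ 2 + X * Y + 6 * Y ^ 2 = 0) {w : F} (hw : w ^ 2 + w + 1 = 0) :
    2 * (∑ k ∈ Finset.range (p / 3 + 1), ((3 * k).choose k : F)) * (2 * X + Y) =
      w ^ (χ p).val * (2 * X + Y + 3 * (1 + 2 * w) * Y) +
        w ^ (-χ p).val * (2 * X + Y - 3 * (1 + 2 * w) * Y) := by
  have h2 : (2 : F) ≠ 0 := mod_cast natCast_ne_zero_of_prime_ne F (q := p) (r := 2) Fact.out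
    Nat.prime_two (by omega)
  have hp3 : p % 3 = 1 ∨ p % 3 = 2 := by
    have : ¬ 3 ∣ p := fun t ↦ by
      have := (Nat.prime_dvd_prime_iff_eq Nat.prime_three Fact.out).1 t
      omega
    omega
  obtain ⟨s, hs⟩ : ∃ s : F, s * Y = 2 * X + Y := ⟨(2 * X + Y) / Y, div_mul_cancel₀ _ hY⟩
  have hs2 : s ^ 2 = -23 := by
    refine mul_right_cancel₀ (pow_ne_zero 2 hY) ?_
    linear_combination (s * Y + 2 * X + Y) * hs + 4 * hXY
  obtain ⟨u, hu⟩ : ∃ u : F, 2 * u = s + 3 * (1 + 2 * w) := ⟨_, mul_div_cancel₀ _ h2⟩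
  obtain ⟨v, hv⟩ : ∃ v : F, 2 * v = s - 3 * (1 + 2 * w) := ⟨_, mul_div_cancel₀ _ h2⟩
  have huv : u * v = 1 := by
    refine mul_left_cancel₀ (pow_ne_zero 2 h2) ?_
    linear_combination 2 * v * hu + (s + 3 * (1 + 2 * w)) * hv + hs2 - 36 * hw
  have hsub : u - v = 3 * (1 + 2 * w) := mul_left_cancel₀ h2 (by linear_combination hu - hv)
  have hadd : u + v = s := mul_left_cancel₀ h2 (by linear_combination hu + hv)
  have h27 : (u - v) ^ 2 = -27 := by rw [hsub]; linear_combination 36 * hw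
  have hA : ((3 * X + 14 * Y : ℤ) : F) + (3 * (2 * X + Y) : ℤ) * w = -Y * v ^ 2 := by
    push_cast
    refine mul_left_cancel₀ (pow_ne_zero 2 h2) ?_
    linear_combination Y * (2 * v + s - 3 * (1 + 2 * w)) * hv + Y * hs2 + 36 * Y * hw
      - 6 * (1 + 2 * w) * hs
  have hA' : ((3 * X + 14 * Y : ℤ) : F) + (3 * (2 * X + Y) : ℤ) * (-1 - w) = -Y * u ^ 2 := by
    push_cast
    refine mul_left_cancel₀ (pow_ne_zero 2 h2) ?_
    linear_combination Y * (2 * u + s + 3 * (1 + 2 * w)) * hu + Y * hs2 + 36 * Y * hw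
      + 6 * (1 + 2 * w) * hs
  have hsum := sum_choose_three_mul (F := F) (p := p) (by omega) huv h27
  have hfs : frobenius F p s = s := by
    refine mul_right_cancel₀ hY ?_
    have := congrArg (frobenius F p) hs
    simp only [map_mul, map_add, map_intCast, map_ofNat] at this
    rw [this, hs]
  have hw3 := cube_root_pow_three hw
  have hj := cube_root_pow_val_mul_neg hw (χ p)
  have hj3 : (w ^ (χ p).val) ^ 3 = 1 := by rw [← pow_mul, mul_comm, pow_mul, hw3, one_pow]
  have hj0 : w ^ (χ p).val ≠ 0 := left_ne_zero_of_mul_eq_one hj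
  have hv0 : v ≠ 0 := right_ne_zero_of_mul_eq_one huv
  have hu0 : u ≠ 0 := left_ne_zero_of_mul_eq_one huv
  have hneg : w ^ (-χ p).val = (w ^ (χ p).val) ^ 2 :=
    mul_left_cancel₀ hj0 (by rw [hj, ← hj3]; ring)
  have hs' := h.split p Fact.out hpN F w hw (p / 3)
  have hi' := h.inert p Fact.out hpN F w hw (p / 3)
  rw [hA, hA'] at hs' hi'
  suffices hS : (∑ k ∈ Finset.range (p / 3 + 1), ((3 * k).choose k : F)) * (u + v) =
      w ^ (χ p).val * u + w ^ (-χ p).val * v by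
    rw [hadd] at hS
    linear_combination (-2 * (∑ k ∈ Finset.range (p / 3 + 1), ((3 * k).choose k : F)) +
      w ^ (χ p).val + w ^ (-χ p).val) * hs + 2 * Y * hS + w ^ (χ p).val * Y * hu
      + w ^ (-χ p).val * Y * hv
  rw [hsum, hneg]
  generalize w ^ (χ p).val = j at *
  have hpow (k : ℕ) : u ^ k * v ^ k = 1 := by rw [← mul_pow, huv, one_pow]
  obtain ⟨m, hmp⟩ : ∃ m, p / 3 = m := ⟨_, rfl⟩
  rw [hmp] at hs' hi' ⊢
  rcases hp3 with hp3 | hp3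
  · have hm : p = 3 * m + 1 := by omega
    have hfw : frobenius F p w = w := by
      rw [frobenius_def, hm, pow_succ, pow_mul, hw3, one_pow, one_mul]
    have hfv : frobenius F p v = v := by
      refine mul_left_cancel₀ h2 ?_
      have := congrArg (frobenius F p) hv
      rw [hv]
      simpa only [map_mul, map_add, map_sub, map_one, map_ofNat, hfs, hfw] using this
    have hv3 : v ^ (3 * m) = 1 := by
      refine mul_right_cancel₀ hv0 ?_
      rw [← pow_succ, ← hm, one_mul]
      exact hfv
    have e := hs' hm
    rw [mul_pow, mul_pow, mul_left_comm] at e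
    replace e := mul_left_cancel₀ (pow_ne_zero m (neg_ne_zero.2 hY)) e
    rw [← pow_mul, ← pow_mul, mul_comm 2, pow_mul, pow_mul] at e
    rw [mul_comm, pow_mul] at hv3
    rw [pow_succ, pow_succ, mul_comm 2, pow_mul, pow_mul]
    have h1 := hpow m
    generalize u ^ m = U at *
    generalize v ^ m = V at *
    have hVj : V = j := by
      linear_combination V ^ 2 * e - V * hv3 + j * (U * V + 1) * h1
    have hUj : U ^ 2 = j := by
      linear_combination hVj - U ^ 2 * hv3 + V * (U * V + 1) * h1
    rw [hUj, hVj]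
  · have hm : p = 3 * m + 2 := by omega
    have hfw : frobenius F p w = -1 - w := by
      rw [frobenius_def, hm, pow_add, pow_mul, hw3, one_pow, one_mul]
      linear_combination hw
    have hfu : frobenius F p u = v := by
      refine mul_left_cancel₀ h2 ?_
      have := congrArg (frobenius F p) hu
      simp only [map_mul, map_add, map_one, map_ofNat, hfs, hfw] at this
      linear_combination this - hv
    have hu3 : u ^ (3 * (m + 1)) = 1 := by
      rw [show 3 * (m + 1) = p + 1 by omega, pow_succ, mul_comm, ← huv]
      exact congrArg _ hfu
    have e := hi' hm
    rw [mul_pow, mul_pow, mul_left_comm] at e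
    replace e := mul_left_cancel₀ (pow_ne_zero (m + 1) (neg_ne_zero.2 hY)) e
    rw [← pow_mul, ← pow_mul, mul_comm 2, pow_mul, pow_mul] at e
    rw [mul_comm, pow_mul] at hu3
    have h1 := hpow (m + 1)
    have hu2 : u ^ (2 * m + 1) = (u ^ (m + 1)) ^ 2 * v := by
      linear_combination -u ^ (2 * m + 1) * huv
    have hv2 : v ^ (2 * m + 1) = (v ^ (m + 1)) ^ 2 * u := by
      linear_combination -v ^ (2 * m + 1) * huv
    rw [hu2, hv2]
    generalize u ^ (m + 1) = U at *
    generalize v ^ (m + 1) = V at *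
    have hUj : U = j := by
      linear_combination U ^ 2 * e - U * hu3 + j * (U * V + 1) * h1
    have hVj : V ^ 2 = j := by
      linear_combination hUj - V ^ 2 * hu3 + U * (U * V + 1) * h1
    rw [hUj, hVj]
    ring

end SumValue

section Represented

variable {X Y : ℤ} {p : ℕ} [Fact p.Prime]

theorem isCoprime_of_mul_prime_eq {c : ℤ} (hc : IsCoprime Y c)
    (h : c * p = X ^ 2 + X * Y + 6 * Y ^ 2) : IsCoprime X Y := by
  refine isRelPrime_iff_isCoprime.1 fun d hX hY ↦ ?_
  have hdc : IsCoprime d c := hc.of_isCoprime_of_dvd_left hY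
  have hd : d * d ∣ c * p := by
    obtain ⟨k, rfl⟩ := hX
    obtain ⟨l, rfl⟩ := hY
    exact h ▸ ⟨k ^ 2 + k * l + 6 * l ^ 2, by ring⟩
  exact (Nat.prime_iff_prime_int.1 Fact.out).irreducible.squarefree d
    ((hdc.mul_left hdc).dvd_of_dvd_mul_left hd)

theorem intCast_eq_one_of_odd {R : Type*} [CommRing R] [CharP R 2] {m : ℤ} (hm : Odd m) :
    (m : R) = 1 := by
  obtain ⟨k, rfl⟩ := hm
  push_cast
  linear_combination k * (mod_cast CharP.cast_eq_zero R 2 : (2 : R) = 0)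

theorem IsCubicSymbol.apply_two_eq_two {a b : ℤ} {χ : ℤ → ZMod 3} (h : IsCubicSymbol a b χ)
    (ha : Odd a) (hb : Odd b) : χ 2 = 2 := by
  let F := AlgebraicClosure (ZMod 2)
  obtain ⟨w, hw⟩ := exists_sq_add_self_add_one_eq_zero F
  have hN : ¬ ((2 : ℕ) : ℤ) ∣ eisNorm a b := by
    rw [Nat.cast_ofNat, ← even_iff_two_dvd, Int.not_even_iff_odd, eisNorm]
    simp [parity_simps, ha]
  have e := h.inert 2 Nat.prime_two hN F w hw 0 rfl
  have h2 : (2 : F) = 0 := mod_cast CharP.cast_eq_zero F 2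
  rw [intCast_eq_one_of_odd ha, intCast_eq_one_of_odd hb, zero_add, pow_one, pow_one,
    Nat.cast_ofNat] at e
  have hc : ∀ c : ZMod 3, c = 0 ∨ c = 1 ∨ c = 2 := by decide
  rcases hc (χ 2) with hc | hc | hc
  · rw [hc, ZMod.val_zero, pow_zero] at e
    refine absurd ?_ (one_ne_zero (α := F))
    linear_combination -e - w * h2
  · rw [hc, ZMod.val_one, pow_one] at e
    refine absurd ?_ (one_ne_zero (α := F))
    linear_combination (1 - w) * hw - w * e - w ^ 2 * h2
  · exact hc

/-- If `2 ^ e * p` is represented by the principal form of discriminant `-23`, then the sum is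
determined by the value at `p`, or at `2`, of a cubic residue symbol. -/
theorem exists_isCubicSymbol_sum_choose (hp : 3 < p) (h23 : p ≠ 23) {e : ℕ}
    (he : e = 0 ∨ Odd Y) (h : 2 ^ e * (p : ℤ) = X ^ 2 + X * Y + 6 * Y ^ 2) (h3 : 3 ∣ X - Y) :
    ∃ i j : ZMod 3, (Odd X → Odd Y → i = 2) ∧ e * i + j = 0 ∧
      (j = 0 → ∑ k ∈ Finset.range (p / 3 + 1), ((3 * k).choose k : ZMod p) = 1) ∧
      (j = 1 → 2 * (∑ k ∈ Finset.range (p / 3 + 1), ((3 * k).choose k : ZMod p)) * (2 * X + Y) =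
        -(2 * X + Y) - 9 * Y) ∧
      (j = 2 → 2 * (∑ k ∈ Finset.range (p / 3 + 1), ((3 * k).choose k : ZMod p)) * (2 * X + Y) =
        -(2 * X + Y) + 9 * Y) := by
  have hc : IsCoprime Y (2 ^ e) := by
    rcases he with rfl | hY
    · exact pow_zero (2 : ℤ) ▸ isCoprime_one_right
    · exact (Int.isCoprime_two_right.2 hY).pow_right
  have hXY := isCoprime_of_mul_prime_eq hc h
  have h3Y : ¬ 3 ∣ Y := fun t ↦ Int.prime_three.not_isUnit
    (hXY.isUnit_of_dvd' ((dvd_iff_dvd_of_dvd_sub h3).2 t) t)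
  obtain ⟨χ, hχ⟩ := exists_isCubicSymbol (3 * X + 14 * Y) (3 * (2 * X + Y)) (by omega)
    (Dvd.intro _ rfl)
  have hn : ((2 ^ e * p : ℕ) : ℤ) = X ^ 2 + X * Y + 6 * Y ^ 2 := by rw [← h]; push_cast; rfl
  have hcp := isCoprime_eisNorm_principal hn hXY
  rw [Nat.cast_mul, Nat.cast_pow, Nat.cast_ofNat] at hcp
  have hpp : Prime (p : ℤ) := Nat.prime_iff_prime_int.1 Fact.out
  have hpN := (hpp.coprime_iff_not_dvd).1 hcp.of_mul_left_right
  have hpY := (hpp.coprime_iff_not_dvd).1 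
    ((isCoprime_principal hn hXY).of_isCoprime_of_dvd_left ⟨2 ^ e, by push_cast; ring⟩)
  have hχn := hχ.apply_principal_eq_zero hn hXY h3Y
  rw [Nat.cast_mul, Nat.cast_pow, Nat.cast_ofNat,
    hχ.apply_mul _ _ hcp.of_mul_left_left hcp.of_mul_left_right,
    hχ.apply_pow hcp.of_mul_left_left] at hχn
  refine ⟨χ 2, χ p, fun hX hY ↦ hχ.apply_two_eq_two ?_ ?_, hχn, ?_⟩
  · exact (Odd.mul (by decide) hX).add_even (Even.mul_right (by decide) _)
  · exact Odd.mul (by decide) ((even_two_mul X).add_odd hY)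
  let F := AlgebraicClosure (ZMod p)
  let f : ZMod p →+* F := algebraMap _ _
  obtain ⟨w, hw⟩ := exists_sq_add_self_add_one_eq_zero F
  have h0 (K : Type) [Field K] [CharP K p] : (X : K) ^ 2 + X * Y + 6 * Y ^ 2 = 0 := by
    have := congrArg (Int.cast (R := K)) h
    push_cast at this
    rw [← this, CharP.cast_eq_zero K p, mul_zero]
  have hY0 (K : Type) [Field K] [CharP K p] : (Y : K) ≠ 0 := fun t ↦
    hpY ((CharP.intCast_eq_zero_iff K p Y).1 t)
  have key := hχ.sum_choose_mul hp hpN F (hY0 F) (h0 F) hw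
  have hS : f (∑ k ∈ Finset.range (p / 3 + 1), ((3 * k).choose k : ZMod p)) =
    ∑ k ∈ Finset.range (p / 3 + 1), ((3 * k).choose k : F) := by simp
  rw [← hS] at key
  set S := ∑ k ∈ Finset.range (p / 3 + 1), ((3 * k).choose k : ZMod p)
  have h2 : (2 : ZMod p) ≠ 0 := mod_cast natCast_ne_zero_of_prime_ne (ZMod p) (q := p) (r := 2)
    Fact.out Nat.prime_two (by omega)
  refine ⟨fun hj ↦ ?_, fun hj ↦ ?_, fun hj ↦ ?_⟩
  · have hne : (2 * X + Y : ZMod p) ≠ 0 := fun t ↦ by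
      have h23' : (23 : ZMod p) ≠ 0 := mod_cast natCast_ne_zero_of_prime_ne (ZMod p) (q := p)
        (r := 23) Fact.out (by norm_num) h23
      refine mul_ne_zero h23' (pow_ne_zero 2 (hY0 (ZMod p))) ?_
      linear_combination 4 * h0 (ZMod p) - (2 * X + Y) * t
    refine mul_right_cancel₀ (mul_ne_zero h2 hne) (f.injective ?_)
    rw [hj, neg_zero, ZMod.val_zero, pow_zero] at key
    simp only [map_mul, map_add, map_one, map_ofNat, map_intCast]
    linear_combination key
  · refine f.injective ?_
    rw [hj, show (1 : ZMod 3).val = 1 from rfl, show (-1 : ZMod 3).val = 2 from rfl] at key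
    simp only [map_mul, map_add, map_sub, map_neg, map_ofNat, map_intCast]
    linear_combination key + (2 * X + 10 * Y - 6 * Y * w) * hw
  · refine f.injective ?_
    rw [hj, show (2 : ZMod 3).val = 2 from rfl, show (-2 : ZMod 3).val = 1 from rfl] at key
    simp only [map_mul, map_add, map_neg, map_ofNat, map_intCast]
    linear_combination key + (2 * X - 8 * Y + 6 * Y * w) * hw

end Represented

theorem odd_and_even_of_prime_eq {p : ℕ} [Fact p.Prime] (hp : 3 < p) {x y a b c : ℤ} (ha : Odd a)
    (hb : Odd b) (hc : Even c) (h : (p : ℤ) = a * x ^ 2 + b * x * y + c * y ^ 2) :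
    Odd x ∧ Even y := by
  have ho : Odd (p : ℤ) := mod_cast (Fact.out : p.Prime).odd_of_ne_two (by omega)
  rw [h] at ho
  rw [← Int.not_even_iff_odd] at *
  simp only [parity_simps, ha, hb, hc] at ho ⊢
  tauto

theorem intCast_ne_zero_of_prime_mul_eq {p : ℕ} [Fact p.Prime] {x y : ℤ} {a b c : ℕ}
    (ha : a.Prime) (hpa : p ≠ a)
    (h : (p : ℤ) = a * x ^ 2 + b * x * y + c * y ^ 2) : (y : ZMod p) ≠ 0 := by
  have hpp : Prime (p : ℤ) := Nat.prime_iff_prime_int.1 Fact.out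
  intro t
  obtain ⟨z, rfl⟩ := (ZMod.intCast_zmod_eq_zero_iff_dvd y p).1 t
  have hx : (p : ℤ) ∣ a * x ^ 2 := ⟨1 - b * x * z - c * p * z ^ 2, by linear_combination -h⟩
  have hx : (p : ℤ) ∣ x := hpp.dvd_of_dvd_pow <| (hpp.dvd_or_dvd hx).resolve_left fun t ↦
    hpa ((Nat.prime_dvd_prime_iff_eq Fact.out ha).1 (Int.natCast_dvd_natCast.1 t))
  obtain ⟨w, rfl⟩ := hx
  refine hpp.not_isUnit (isUnit_iff_exists_inv.2 ⟨a * w ^ 2 + b * w * z + c * z ^ 2, ?_⟩)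
  refine mul_left_cancel₀ hpp.ne_zero ?_
  linear_combination -h

theorem stmt16 (p : ℕ) [Fact p.Prime] (hp : 3 < p) (h23 : legendreSym 23 p = 1) :
    ((∃ x y : ℤ, (p : ℤ) = x ^ 2 + x * y + 52 * y ^ 2 ∨
        (p : ℤ) = 8 * x ^ 2 + 7 * x * y + 8 * y ^ 2) →
      (∑ k ∈ Finset.range (p / 3 + 1), (Nat.choose (3 * k) k : ZMod p)) = 1) ∧
    (p ≠ 13 → ∀ x y : ℤ, (p : ℤ) = 13 * x ^ 2 + x * y + 4 * y ^ 2 →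
      (∑ k ∈ Finset.range (p / 3 + 1), (Nat.choose (3 * k) k : ZMod p))
        = (39 * (x : ZMod p) - 10 * (y : ZMod p)) / (23 * (y : ZMod p))) ∧
    (p ≠ 29 → ∀ x y : ℤ, (p : ℤ) = 29 * x ^ 2 + 5 * x * y + 2 * y ^ 2 →
      (∑ k ∈ Finset.range (p / 3 + 1), (Nat.choose (3 * k) k : ZMod p))
        = -(87 * (x : ZMod p) + 19 * (y : ZMod p)) / (23 * (y : ZMod p))) := by
  have hp23 : p ≠ 23 := by
    rintro rfl
    rw [(legendreSym.eq_zero_iff 23 _).2 (by rfl)] at h23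
    exact zero_ne_one h23
  have hne (r : ℕ) (hr : r.Prime) (hpr : p ≠ r) : ((r : ℕ) : ZMod p) ≠ 0 :=
    natCast_ne_zero_of_prime_ne (ZMod p) (q := p) Fact.out hr hpr
  have h2 : (2 : ZMod p) ≠ 0 := mod_cast hne 2 Nat.prime_two (by omega)
  have h3 : (3 : ZMod p) ≠ 0 := mod_cast hne 3 Nat.prime_three (by omega)
  have h23' : (23 : ZMod p) ≠ 0 := mod_cast hne 23 (by norm_num) hp23
  have hcast {z : ℤ} (h : (p : ℤ) = z) : (z : ZMod p) = 0 := by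
    rw [← h, Int.cast_natCast, CharP.cast_eq_zero]
  refine ⟨?_, fun hp13 x y h ↦ ?_, fun hp29 x y h ↦ ?_⟩
  · rintro ⟨x, y, h | h⟩
    · obtain ⟨hx, hy⟩ := odd_and_even_of_prime_eq hp (x := x) (y := y) (a := 1) (b := 1) (c := 52)
        (by decide) (by decide) (by decide) (by rw [h]; ring)
      have hY : Odd (x + 5 * y) := hx.add_even (hy.mul_left 5)
      obtain ⟨i, j, -, hn, hS, -, -⟩ := exists_isCubicSymbol_sum_choose hp hp23 (e := 3)
        (X := x - 19 * y) (.inr hY) (by rw [h]; ring) ⟨-8 * y, by ring⟩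
      refine hS ?_
      rwa [show ((3 : ℕ) : ZMod 3) = 0 from rfl, zero_mul, zero_add] at hn
    · obtain ⟨i, j, -, hn, hS, -, -⟩ := exists_isCubicSymbol_sum_choose hp hp23 (e := 0)
        (X := x - 2 * y) (Y := x + y) (.inl rfl) (by rw [h]; ring) ⟨-y, by ring⟩
      refine hS ?_
      rwa [Nat.cast_zero, zero_mul, zero_add] at hn
  · obtain ⟨hx, hy⟩ := odd_and_even_of_prime_eq hp (x := x) (y := y) (a := 13) (b := 1) (c := 4)
      (by decide) (by decide) (by decide) (by rw [h]; ring)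
    have hX : Odd (5 * x + y) := (Odd.mul (by decide) hx).add_even hy
    have hY : Odd (y - x) := hy.sub_odd hx
    obtain ⟨i, j, hi, hn, -, hS, -⟩ := exists_isCubicSymbol_sum_choose hp hp23 (e := 1)
      (X := 5 * x + y) (.inr hY) (by rw [h]; ring) ⟨2 * x, by ring⟩
    have hy0 := intCast_ne_zero_of_prime_mul_eq (p := p) (x := x) (y := y) (a := 13) (b := 1)
      (c := 4) (by norm_num) hp13 (by rw [h]; push_cast; ring)
    rw [hi hX hY, Nat.cast_one, one_mul] at hn
    specialize hS (by rw [eq_neg_of_add_eq_zero_right hn]; rfl)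
    have h0 := hcast h
    push_cast at h0 hS
    have hne0 : (3 * x + y : ZMod p) ≠ 0 := fun t ↦ by
      refine mul_ne_zero (mul_ne_zero h2 h23') (pow_ne_zero 2 hy0) ?_
      linear_combination 9 * h0 - (39 * x - 10 * y) * t
    rw [eq_div_iff (mul_ne_zero h23' hy0)]
    refine mul_right_cancel₀ (mul_ne_zero (mul_ne_zero h2 h3) hne0) ?_
    linear_combination 23 * y * hS - 54 * h0
  · obtain ⟨hx, hy⟩ := odd_and_even_of_prime_eq hp (x := x) (y := y) (a := 29) (b := 5) (c := 2)
      (by decide) (by decide) (by decide) h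
    have hX : Odd (11 * x + y) := (Odd.mul (by decide) hx).add_even hy
    have hY : Odd (y - x) := hy.sub_odd hx
    obtain ⟨i, j, hi, hn, -, -, hS⟩ := exists_isCubicSymbol_sum_choose hp hp23 (e := 2)
      (X := 11 * x + y) (.inr hY) (by rw [h]; ring) ⟨4 * x, by ring⟩
    have hy0 := intCast_ne_zero_of_prime_mul_eq (p := p) (x := x) (y := y) (a := 29) (b := 5)
      (c := 2) (by norm_num) hp29 h
    rw [hi hX hY] at hn
    specialize hS (by rw [eq_neg_of_add_eq_zero_right hn]; rfl)
    have h0 := hcast h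
    push_cast at h0 hS
    have hne0 : (7 * x + y : ZMod p) ≠ 0 := fun t ↦ by
      refine mul_ne_zero (mul_ne_zero (pow_ne_zero 2 h2) h23') (pow_ne_zero 2 hy0) ?_
      linear_combination 49 * h0 - (203 * x + 6 * y) * t
    rw [eq_div_iff (mul_ne_zero h23' hy0)]
    refine mul_right_cancel₀ (mul_ne_zero (mul_ne_zero h2 h3) hne0) ?_
    linear_combination 23 * y * hS + 126 * h0
end

section
/- Let p > 3 be a prime and let a be an integer with Legendre symbol (a(4 − 27a)|p) = −1. Let s ∈ ℤ/pℤ be the image of ∑_{k=0}^{⌊p/3⌋} C(3k,k)·a^k. Then s is the unique solution in ℤ/pℤ of the cubic congruence (27a − 4)x³ + 3x + 1 ≡ 0 (mod p); that is, (27a − 4)s³ + 3s + 1 = 0 in ℤ/pℤ, and every t ∈ ℤ/pℤ with (27a − 4)t³ + 3t + 1 = 0 equals s. -/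
/-- The even-index binomial sum `∑ C(n+k, 2k) y^k` of Morgan-Voyce. -/
def morganVoyceEven {R : Type*} [CommRing R] (y : R) (n : ℕ) : R :=
  ∑ k ∈ Finset.range (n + 1), (Nat.choose (n + k) (2 * k) : R) * y ^ k

/-- The odd-index binomial sum `∑ C(n+k+1, 2k+1) y^k` of Morgan-Voyce. -/
def morganVoyceOdd {R : Type*} [CommRing R] (y : R) (n : ℕ) : R :=
  ∑ k ∈ Finset.range (n + 1), (Nat.choose (n + k + 1) (2 * k + 1) : R) * y ^ k

theorem morganVoyceEven_succ {R : Type*} [CommRing R] (y : R) (n : ℕ) :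
    morganVoyceEven y (n + 1) = morganVoyceEven y n + y * morganVoyceOdd y n := by
  have hE : morganVoyceEven y n =
      ∑ k ∈ Finset.range (n + 1 + 1), (Nat.choose (n + k) (2 * k) : R) * y ^ k := by
    rw [Finset.sum_range_succ, Nat.choose_eq_zero_of_lt (by omega)]
    simp [morganVoyceEven]
  rw [hE, morganVoyceEven, morganVoyceOdd, Finset.sum_range_succ', Finset.sum_range_succ' _ (n + 1),
    Finset.mul_sum]
  simp only [add_zero]
  rw [add_right_comm (∑ k ∈ Finset.range (n + 1), _), ← Finset.sum_add_distrib]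
  congr 1
  · refine Finset.sum_congr rfl fun k _ => ?_
    rw [show n + 1 + (k + 1) = (n + k + 1) + 1 by ring, show 2 * (k + 1) = (2 * k + 1) + 1 by ring,
      Nat.choose_succ_succ, ← add_assoc n k 1]
    push_cast
    ring
  · simp

theorem morganVoyceOdd_succ {R : Type*} [CommRing R] (y : R) (n : ℕ) :
    morganVoyceOdd y (n + 1) = morganVoyceOdd y n + morganVoyceEven y (n + 1) := by
  have hO : morganVoyceOdd y n =
      ∑ k ∈ Finset.range (n + 1 + 1), (Nat.choose (n + k + 1) (2 * k + 1) : R) * y ^ k := by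
    rw [Finset.sum_range_succ, Nat.choose_eq_zero_of_lt (by omega)]
    simp [morganVoyceOdd]
  rw [hO, morganVoyceOdd, morganVoyceEven, ← Finset.sum_add_distrib]
  refine Finset.sum_congr rfl fun k _ => ?_
  rw [Nat.choose_succ_succ, show n + 1 + k = n + k + 1 by ring]
  push_cast
  ring

theorem morganVoyce_closed_form {R : Type*} [CommRing R] {w z : R} (hwz : w * z = 1) (n : ℕ) :
    morganVoyceEven ((w - z) ^ 2) n * (w + z) = w ^ (2 * n + 1) + z ^ (2 * n + 1) ∧
      morganVoyceOdd ((w - z) ^ 2) n * ((w + z) * (w - z)) =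
        w ^ (2 * n + 2) - z ^ (2 * n + 2) := by
  induction n with
  | zero => simp [morganVoyceEven, morganVoyceOdd]; ring
  | succ n ih =>
    obtain ⟨hE, hO⟩ := ih
    have hE' : morganVoyceEven ((w - z) ^ 2) (n + 1) * (w + z) =
        w ^ (2 * (n + 1) + 1) + z ^ (2 * (n + 1) + 1) := by
      rw [morganVoyceEven_succ]
      linear_combination hE + (w - z) * hO - (w ^ (2 * n + 1) + z ^ (2 * n + 1)) * hwz
    refine ⟨hE', ?_⟩
    rw [morganVoyceOdd_succ]
    linear_combination hO + (w - z) * hE' - (w ^ (2 * n + 2) - z ^ (2 * n + 2)) * hwz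

theorem choose_three_mul_succ (k : ℕ) :
    (2 * k + 2) * (2 * k + 1) * Nat.choose (3 * (k + 1)) (k + 1) =
      3 * (3 * k + 2) * (3 * k + 1) * Nat.choose (3 * k) k := by
  have h1 := Nat.add_one_mul_choose_eq (3 * k + 2) k
  have h2 := Nat.choose_mul_succ_eq (3 * k + 1) k
  have h3 := Nat.choose_mul_succ_eq (3 * k) k
  rw [show 3 * k + 1 + 1 - k = 2 * k + 2 by omega] at h2
  rw [show 3 * k + 1 - k = 2 * k + 1 by omega] at h3
  rw [show 3 * (k + 1) = 3 * k + 2 + 1 by ring]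
  apply Nat.eq_of_mul_eq_mul_right (Nat.succ_pos k)
  zify at *
  linear_combination (-(2 * k + 2) * (2 * k + 1) : ℤ) * h1 - 3 * (k + 1) * (2 * k + 1) * h2 -
    3 * (k + 1) * (3 * k + 2) * h3

theorem choose_add_two_mul_succ {n k : ℕ} (hk : k ≤ n) :
    ((2 * k + 2) * (2 * k + 1) * Nat.choose (n + (k + 1)) (2 * (k + 1)) : ℤ) =
      (n + k + 1) * (n - k) * Nat.choose (n + k) (2 * k) := by
  have h1 := Nat.add_one_mul_choose_eq (n + k) (2 * k + 1)
  have h2 := Nat.choose_succ_right_eq (n + k) (2 * k)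
  rw [show n + k - 2 * k = n - k by omega] at h2
  rw [show n + (k + 1) = n + k + 1 by ring, show 2 * (k + 1) = 2 * k + 1 + 1 by ring]
  zify [hk] at h1 h2
  linear_combination -(2 * k + 1 : ℤ) * h1 + (n + k + 1 : ℤ) * h2

theorem natCast_ne_zero_of_pos_of_lt (R : Type*) [AddMonoidWithOne R] {p m : ℕ} [CharP R p]
    (h0 : 0 < m) (hm : m < p) : (m : R) ≠ 0 := fun h =>
  absurd (Nat.le_of_dvd h0 ((CharP.cast_eq_zero_iff R p m).1 h)) (by omega)

theorem Nat.Prime.mod_three_eq_one_or_two {p : ℕ} (hpp : p.Prime) (hp : 3 < p) :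
    p % 3 = 1 ∨ p % 3 = 2 := by
  have : ¬ 3 ∣ p := fun h => by
    have := (Nat.prime_dvd_prime_iff_eq Nat.prime_three hpp).1 h
    omega
  omega

theorem pow_eq_mul_sq_pow_half {M : Type*} [Monoid M] {n : ℕ} (hn : Odd n) (y : M) :
    y ^ n = y * (y ^ 2) ^ (n / 2) := by
  rw [← pow_mul, ← pow_succ', Nat.two_mul_div_two_add_one_of_odd hn]

theorem choose_three_mul_eq_neg_pow_mul_choose {p : ℕ} [Fact p.Prime] (hp : 3 < p) {k : ℕ}
    (hk : k ≤ p / 3) :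
    (Nat.choose (3 * k) k : ZMod p) = (-27) ^ k * Nat.choose (p / 3 + k) (2 * k) := by
  induction k with
  | zero => simp
  | succ k ih =>
    have ih := ih (by omega)
    have hne : ((2 * k + 2 : ℕ) : ZMod p) * ((2 * k + 1 : ℕ) : ZMod p) ≠ 0 :=
      mul_ne_zero (natCast_ne_zero_of_pos_of_lt _ (by omega) (by omega))
        (natCast_ne_zero_of_pos_of_lt _ (by omega) (by omega))
    have h1 := congrArg (Nat.cast : ℕ → ZMod p) (choose_three_mul_succ k)
    have h2 : (2 * k + 2) * (2 * k + 1) * (Nat.choose (p / 3 + (k + 1)) (2 * (k + 1)) : ZMod p) =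
        ((p / 3 : ℕ) + k + 1) * ((p / 3 : ℕ) - k) * Nat.choose (p / 3 + k) (2 * k) := by
      have h := choose_add_two_mul_succ (n := p / 3) (k := k) (by omega)
      generalize p / 3 = n at h
      exact_mod_cast congrArg (Int.cast : ℤ → ZMod p) h
    have h3 : -9 * ((p / 3 : ℕ) + k + 1 : ZMod p) * ((p / 3 : ℕ) - k) =
        (3 * k + 2) * (3 * k + 1) := by
      have h0 : ((3 * (p / 3) + p % 3 : ℕ) : ZMod p) = 0 := by
        rw [Nat.div_add_mod, ZMod.natCast_self]
      generalize p / 3 = n at h0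
      rcases (Fact.out : p.Prime).mod_three_eq_one_or_two hp with h | h <;> rw [h] at h0 <;> push_cast at h0
      · linear_combination (-3 * (n : ZMod p) - 2) * h0
      · linear_combination (-3 * (n : ZMod p) - 1) * h0
    apply mul_left_cancel₀ hne
    push_cast at h1 ⊢
    generalize (Nat.choose (p / 3 + (k + 1)) (2 * (k + 1)) : ZMod p) = u at *
    linear_combination h1 + 3 * (3 * k + 2 : ZMod p) * (3 * k + 1) * ih -
      (-27) ^ (k + 1) * h2 -
      3 * (-27) ^ k * (Nat.choose (p / 3 + k) (2 * k) : ZMod p) * h3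

theorem sum_choose_three_mul_eq_morganVoyceEven {p : ℕ} [Fact p.Prime] (hp : 3 < p)
    (x : ZMod p) :
    ∑ k ∈ Finset.range (p / 3 + 1), (Nat.choose (3 * k) k : ZMod p) * x ^ k =
      morganVoyceEven (-27 * x) (p / 3) := by
  refine Finset.sum_congr rfl fun k hk => ?_
  rw [choose_three_mul_eq_neg_pow_mul_choose hp (Nat.lt_succ_iff.1 (Finset.mem_range.1 hk)),
    mul_pow]
  ring

/-- If the cubic has two distinct roots, then its discriminant is a square. -/
theorem isSquare_of_cubic_roots_ne {F : Type*} [Field F] (h3 : (3 : F) ≠ 0) {x s t : F}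
    (hs : (27 * x - 4) * s ^ 3 + 3 * s + 1 = 0) (ht : (27 * x - 4) * t ^ 3 + 3 * t + 1 = 0)
    (hne : t ≠ s) : IsSquare (x * (4 - 27 * x)) := by
  set A := 27 * x - 4 with hA
  have h1 : A * (s ^ 2 + s * t + t ^ 2) = -3 := by
    apply mul_left_cancel₀ (sub_ne_zero.2 hne)
    linear_combination ht - hs
  have h2 : A * (s * t * (s + t)) = 1 := by
    linear_combination s * h1 - hs
  have h4 : (A ^ 2 * ((s - t) * (2 * s + t) * (s + 2 * t))) ^ 2 =
      4 * A * (A * (s ^ 2 + s * t + t ^ 2)) ^ 3 - 27 * A ^ 2 * (A * (s * t * (s + t))) ^ 2 := by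
    ring
  rw [h1, h2] at h4
  refine ⟨A ^ 2 * ((s - t) * (2 * s + t) * (s + 2 * t)) / 3 ^ 3, ?_⟩
  rw [← mul_div_mul_comm, ← sq, h4, eq_div_iff (mul_ne_zero (pow_ne_zero 3 h3) (pow_ne_zero 3 h3)), hA]
  ring

theorem neg_three_pow_half {p : ℕ} [Fact p.Prime] (hp : 3 < p) :
    p % 3 = 1 ∧ (-3 : ZMod p) ^ (p / 2) = 1 ∨ p % 3 = 2 ∧ (-3 : ZMod p) ^ (p / 2) = -1 := by
  obtain ⟨K, _, _, _⟩ : ∃ (K : Type) (_ : Field K) (_ : Algebra (ZMod p) K), IsAlgClosed K :=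
    ⟨AlgebraicClosure (ZMod p), inferInstance, inferInstance, inferInstance⟩
  have : CharP K p := charP_of_injective_algebraMap (algebraMap (ZMod p) K).injective p
  have hpp : p.Prime := Fact.out
  have hodd : Odd p := hpp.odd_of_ne_two (by omega)
  have h2K : (2 : K) ≠ 0 :=
    mod_cast natCast_ne_zero_of_pos_of_lt K (p := p) (m := 2) (by omega) (by omega)
  have h3K : (3 : K) ≠ 0 :=
    mod_cast natCast_ne_zero_of_pos_of_lt K (p := p) (m := 3) (by omega) (by omega)
  obtain ⟨θ, hθ⟩ := IsAlgClosed.exists_pow_nat_eq (-3 : K) (n := 2) (by norm_num)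
  obtain ⟨ω, hω⟩ : ∃ ω : K, θ = 1 + ω + ω := ⟨(θ - 1) / 2, by field_simp; ring⟩
  have hω2 : ω ^ 2 + ω + 1 = 0 := by
    have : (2 * 2 : K) * (ω ^ 2 + ω + 1) = 0 := by
      rw [hω] at hθ
      linear_combination hθ
    exact (mul_eq_zero.1 this).resolve_left (mul_ne_zero h2K h2K)
  have hω3 : ω ^ 3 = 1 := by linear_combination (ω - 1) * hω2
  have hθ0 : θ ≠ 0 := fun h => h3K (by rw [h] at hθ; linear_combination hθ)
  have hθp : θ ^ p = 1 + ω ^ (p % 3) + ω ^ (p % 3) := by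
    rw [hω, add_pow_char, add_pow_char, one_pow, ← pow_eq_pow_mod p hω3]
  have hθp' : θ ^ p = θ * (-3) ^ (p / 2) := by
    rw [pow_eq_mul_sq_pow_half hodd, hθ]
  have hinj := (algebraMap (ZMod p) K).injective
  rcases hpp.mod_three_eq_one_or_two hp with h | h
  · refine Or.inl ⟨h, hinj (mul_left_cancel₀ hθ0 ?_)⟩
    simp only [map_pow, map_neg, map_ofNat, map_one]
    rw [← hθp', hθp, h, hω]
    ring
  · refine Or.inr ⟨h, hinj (mul_left_cancel₀ hθ0 ?_)⟩
    simp only [map_pow, map_neg, map_ofNat, map_one]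
    rw [← hθp', hθp, h, hω]
    linear_combination 2 * hω2

theorem cubic_morganVoyceEven_eq_zero {p : ℕ} [Fact p.Prime] (hp : 3 < p) {x : ZMod p}
    (hx : (x * (4 - 27 * x)) ^ (p / 2) = -1) :
    (27 * x - 4) * morganVoyceEven (-27 * x) (p / 3) ^ 3 +
      3 * morganVoyceEven (-27 * x) (p / 3) + 1 = 0 := by
  obtain ⟨K, _, _, _⟩ : ∃ (K : Type) (_ : Field K) (_ : Algebra (ZMod p) K), IsAlgClosed K :=
    ⟨AlgebraicClosure (ZMod p), inferInstance, inferInstance, inferInstance⟩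
  have : CharP K p := charP_of_injective_algebraMap (algebraMap (ZMod p) K).injective p
  have hpp : p.Prime := Fact.out
  have hodd : Odd p := hpp.odd_of_ne_two (by omega)
  have h3 : (3 : ZMod p) ≠ 0 :=
    mod_cast natCast_ne_zero_of_pos_of_lt (ZMod p) (m := 3) (by omega) hp
  have h2 : (2 : K) ≠ 0 :=
    mod_cast natCast_ne_zero_of_pos_of_lt K (p := p) (m := 2) (by omega) (by omega)
  have hx0 : 4 - 27 * x ≠ 0 := fun h => by
    rw [h, mul_zero, zero_pow (by omega)] at hx
    exact neg_ne_zero.2 one_ne_zero hx.symm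
  let f := algebraMap (ZMod p) K
  obtain ⟨c, hc⟩ := IsAlgClosed.exists_pow_nat_eq (f (4 - 27 * x)) (n := 2) (by norm_num)
  obtain ⟨e, he⟩ := IsAlgClosed.exists_pow_nat_eq (f (-27 * x)) (n := 2) (by norm_num)
  have hc0 : c ≠ 0 := fun h => hx0 <| by
    rw [h, zero_pow two_ne_zero, eq_comm] at hc
    exact (map_eq_zero f).1 hc
  have hce : c ^ 2 - e ^ 2 = 4 := by
    rw [hc, he, ← map_sub, show 4 - 27 * x - -27 * x = 4 by ring, map_ofNat]
  obtain ⟨w, z, hw, hz⟩ : ∃ w z : K, w + z = c ∧ w - z = e :=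
    ⟨(c + e) / 2, (c - e) / 2, by field_simp; ring, by field_simp; ring⟩
  have hwz : w * z = 1 := by
    apply mul_left_cancel₀ (mul_ne_zero h2 h2)
    rw [← hw, ← hz] at hce
    linear_combination hce
  have hcec : (w ^ 2 - z ^ 2) ^ 2 = f (-3 * 3 ^ 2 * (x * (4 - 27 * x))) := by
    rw [show -3 * 3 ^ 2 * (x * (4 - 27 * x)) = (4 - 27 * x) * (-27 * x) by ring, map_mul, ← hc,
      ← he, ← hw, ← hz]
    ring
  have hfrob : (w ^ 2 - z ^ 2) ^ p = -(w ^ 2 - z ^ 2) * f ((-3) ^ (p / 2)) := by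
    have h9 : (3 : ZMod p) ^ (2 * (p / 2)) = 1 := by
      rw [show 2 * (p / 2) = p - 1 by grind, ZMod.pow_card_sub_one_eq_one h3]
    rw [pow_eq_mul_sq_pow_half hodd, hcec, ← map_pow, mul_pow, mul_pow, ← pow_mul, hx, h9,
      mul_one, mul_neg_one, map_neg]
    ring
  have hsum : (w ^ 2 + z ^ 2) ^ p = w ^ 2 + z ^ 2 := by
    have : w ^ 2 + z ^ 2 = f (2 - 27 * x) := by
      rw [show 2 - 27 * x = 4 - 27 * x - 2 by ring, map_sub, ← hc, ← hw, map_ofNat]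
      linear_combination -2 * hwz
    rw [this, ← map_pow, ZMod.pow_card]
  rw [sub_pow_char] at hfrob
  rw [add_pow_char] at hsum
  have hpow : w ^ (3 * (2 * (p / 3) + 1)) + z ^ (3 * (2 * (p / 3) + 1)) = w + z := by
    rcases neg_three_pow_half hp with ⟨h, hq⟩ | ⟨h, hq⟩ <;> rw [hq] at hfrob
    · rw [map_one] at hfrob
      have hwp : (w ^ 2) ^ p = z ^ 2 := mul_left_cancel₀ h2 (by linear_combination hsum + hfrob)
      have hzp : (z ^ 2) ^ p = w ^ 2 := mul_left_cancel₀ h2 (by linear_combination hsum - hfrob)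
      rw [show 3 * (2 * (p / 3) + 1) = 2 * p + 1 by omega, pow_succ, pow_succ, pow_mul, pow_mul,
        hwp, hzp]
      linear_combination (w + z) * hwz
    · rw [map_neg, map_one] at hfrob
      have hwp : (w ^ 2) ^ p = w ^ 2 := mul_left_cancel₀ h2 (by linear_combination hsum + hfrob)
      have hzp : (z ^ 2) ^ p = z ^ 2 := mul_left_cancel₀ h2 (by linear_combination hsum - hfrob)
      rw [← pow_mul, show 2 * p = 3 * (2 * (p / 3) + 1) + 1 by omega, pow_succ] at hwp hzp
      congr 1
      · exact mul_right_cancel₀ (left_ne_zero_of_mul_eq_one hwz) (hwp.trans (sq w))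
      · exact mul_right_cancel₀ (right_ne_zero_of_mul_eq_one hwz) (hzp.trans (sq z))
  have hmap : f (morganVoyceEven (-27 * x) (p / 3)) = morganVoyceEven ((w - z) ^ 2) (p / 3) := by
    rw [hz, he]
    simp only [morganVoyceEven, map_sum, map_mul f, map_pow, map_natCast]
  have hclosed := (morganVoyce_closed_form hwz (p / 3)).1
  rw [← hmap] at hclosed
  apply f.injective
  rw [show 27 * x - 4 = -(4 - 27 * x) by ring]
  generalize morganVoyceEven (-27 * x) (p / 3) = S at *
  simp only [map_add, map_mul f, map_pow, map_neg, map_ofNat, map_one, map_zero, ← hc, ← hw]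
  rw [← hw] at hc0
  generalize hm : 2 * (p / 3) + 1 = m at *
  rw [mul_comm 3 m, pow_mul, pow_mul] at hpow
  have hwzm : w ^ m * z ^ m = 1 := by rw [← mul_pow, hwz, one_pow]
  have hcube : (f S * (w + z)) ^ 3 - 3 * (f S * (w + z)) = w + z := by
    rw [hclosed]
    linear_combination hpow + 3 * (w ^ m + z ^ m) * hwzm
  apply mul_left_cancel₀ hc0
  linear_combination -hcube

theorem stmt17 (p : ℕ) [Fact p.Prime] (hp : 3 < p) (a : ℤ)
    (ha : legendreSym p (a * (4 - 27 * a)) = -1) :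
    ((27 * (a : ZMod p) - 4) *
        (∑ k ∈ Finset.range (p / 3 + 1),
          (Nat.choose (3 * k) k : ZMod p) * (a : ZMod p) ^ k) ^ 3 +
       3 * (∑ k ∈ Finset.range (p / 3 + 1),
          (Nat.choose (3 * k) k : ZMod p) * (a : ZMod p) ^ k) + 1 = 0) ∧
    (∀ t : ZMod p, (27 * (a : ZMod p) - 4) * t ^ 3 + 3 * t + 1 = 0 →
      t = ∑ k ∈ Finset.range (p / 3 + 1),
        (Nat.choose (3 * k) k : ZMod p) * (a : ZMod p) ^ k) := by
  have h3 : (3 : ZMod p) ≠ 0 :=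
    mod_cast natCast_ne_zero_of_pos_of_lt (ZMod p) (m := 3) (by omega) hp
  have hroot : (27 * (a : ZMod p) - 4) * morganVoyceEven (-27 * (a : ZMod p)) (p / 3) ^ 3 +
      3 * morganVoyceEven (-27 * (a : ZMod p)) (p / 3) + 1 = 0 := by
    apply cubic_morganVoyceEven_eq_zero hp
    have h := legendreSym.eq_pow p (a * (4 - 27 * a))
    rw [ha] at h
    push_cast at h
    exact h.symm
  rw [sum_choose_three_mul_eq_morganVoyceEven hp]
  refine ⟨hroot, fun t ht => ?_⟩
  by_contra hne
  refine (legendreSym.eq_neg_one_iff p).1 ha ?_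
  have hsq := isSquare_of_cubic_roots_ne h3 hroot ht hne
  push_cast
  exact hsq
end
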